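/- arXiv:2601.22375 — 3 statements merged into one kernel-verified Lean document; each statement's English description precedes it below -/
import Mathlib

section
/- Second-moment Weingarten formula for the unitary group: let N ≥ 2 and let dμ_H be the Haar probability measure on the unitary group U(N). Then for all indices i₁,i₂,j₁,j₂,k₁,k₂,l₁,l₂ ∈ {1,…,N}: ∫_{U(N)} U_{i₁j₁} U_{i₂j₂} conj(U_{k₁l₁}) conj(U_{k₂l₂}) dμ_H(U) = (1/(N²−1)) [δ_{i₁k₁}δ_{i₂k₂}δ_{j₁l₁}δ_{j₂l₂} + δ_{i₁k₂}δ_{i₂k₁}δ_{j₁l₂}δ_{j₂l₁}] − (1/(N(N²−1))) [δ_{i₁k₁}δ_{i₂k₂}δ_{j₁l₂}δ_{j₂l₁} + δ_{i₁k₂}δ_{i₂k₁}δ_{j₁l₁}δ_{j₂l₂}]. -/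
/- Second-moment Weingarten formula for the unitary group `U(N)`.
The Haar probability measure is characterized as a left-invariant Borel probability
measure on the compact group `U(N)` (this determines it uniquely). -/

open MeasureTheory

noncomputable instance (n : Type*) [Fintype n] [DecidableEq n] :
    MeasurableSpace (Matrix.unitaryGroup n ℂ) := borel _

instance (n : Type*) [Fintype n] [DecidableEq n] :
    BorelSpace (Matrix.unitaryGroup n ℂ) := ⟨rfl⟩

/-- Kronecker delta with values in `ℂ`. -/
def kdelta {α : Type*} [DecidableEq α] (a b : α) : ℂ := if a = b then 1 else 0

theorem exists_perm_pair {n : Type*} [DecidableEq n] {p q r s : n} (hpq : p ≠ q)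
    (hrs : r ≠ s) :
    ∃ σ : Equiv.Perm n, σ p = r ∧ σ q = s := by
  refine ⟨Equiv.swap (Equiv.swap p r q) s * Equiv.swap p r, ?_, by simp⟩
  rw [Equiv.Perm.mul_apply, Equiv.swap_apply_left, Equiv.swap_apply_of_ne_of_ne _ hrs]
  intro h
  exact hpq ((Equiv.swap p r).injective (by rw [← h, Equiv.swap_apply_left]))

/-- A tensor fixed by `V ⊗ V ⊗ conj V ⊗ conj V` for all unitary `V`. -/
def UnitaryInvariantTensor {n : Type*} [Fintype n] [DecidableEq n] (T : n → n → n → n → ℂ) :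
    Prop :=
  ∀ V ∈ Matrix.unitaryGroup n ℂ, ∀ i₁ i₂ k₁ k₂,
    T i₁ i₂ k₁ k₂ = ∑ a, V i₁ a * ∑ b, V i₂ b * ∑ c, star (V k₁ c) * ∑ d, star (V k₂ d) * T a b c d

namespace UnitaryInvariantTensor

variable {n : Type*} [Fintype n] [DecidableEq n] {T : n → n → n → n → ℂ}

theorem eq_diagonal (hT : UnitaryInvariantTensor T) {d : n → ℂ} (hd : ∀ i, d i * star (d i) = 1)
    (i₁ i₂ k₁ k₂ : n) :
    T i₁ i₂ k₁ k₂ = d i₁ * (d i₂ * (star (d k₁) * (star (d k₂) * T i₁ i₂ k₁ k₂))) := by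
  have hV : Matrix.diagonal d ∈ Matrix.unitaryGroup n ℂ := by
    rw [Matrix.mem_unitaryGroup_iff, Matrix.star_eq_conjTranspose, Matrix.diagonal_conjTranspose,
      Matrix.diagonal_mul_diagonal, ← Matrix.diagonal_one]
    exact congrArg _ (funext hd)
  have key := hT _ hV i₁ i₂ k₁ k₂
  simpa only [Matrix.diagonal_apply, apply_ite star, star_zero, ite_mul, zero_mul,
    Finset.sum_ite_eq, Finset.mem_univ, if_true] using key

theorem eq_perm (hT : UnitaryInvariantTensor T) (σ : Equiv.Perm n) (i₁ i₂ k₁ k₂ : n) :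
    T i₁ i₂ k₁ k₂ = T (σ i₁) (σ i₂) (σ k₁) (σ k₂) := by
  have hV : (Matrix.of fun i a => if σ i = a then (1 : ℂ) else 0) ∈ Matrix.unitaryGroup n ℂ := by
    rw [Matrix.mem_unitaryGroup_iff]
    ext i j
    simp [Matrix.mul_apply, Matrix.star_apply, Matrix.one_apply, eq_comm]
  have key := hT _ hV i₁ i₂ k₁ k₂
  simpa only [Matrix.of_apply, apply_ite star, star_zero, star_one, one_mul, ite_mul, zero_mul,
    Finset.sum_ite_eq, Finset.mem_univ, if_true] using key

theorem eq_zero (hT : UnitaryInvariantTensor T) {i₁ i₂ k₁ k₂ : n}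
    (h : ¬(i₁ = k₁ ∧ i₂ = k₂)) (h' : ¬(i₁ = k₂ ∧ i₂ = k₁)) : T i₁ i₂ k₁ k₂ = 0 := by
  have key : ∀ p : n, _ := fun p => hT.eq_diagonal (d := fun i => if i = p then Complex.I else 1)
    (fun i => by split_ifs <;> simp) i₁ i₂ k₁ k₂
  have h₁ := key i₁
  have h₂ := key i₂
  have hI : ∀ z : ℂ, z = Complex.I * z → z = 0 := fun z hz => by
    have := congrArg Complex.re hz
    have := congrArg Complex.im hz
    apply Complex.ext <;> simp at * <;> linarith
  have hI' : ∀ z : ℂ, z = -(Complex.I * z) → z = 0 := fun z hz => by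
    have := congrArg Complex.re hz
    have := congrArg Complex.im hz
    apply Complex.ext <;> simp at * <;> linarith
  have hn : ∀ z : ℂ, z = -z → z = 0 := fun z hz => by linear_combination hz / 2
  have hm : ∀ z : ℂ, Complex.I * (Complex.I * z) = -z := fun z => by
    linear_combination z * Complex.I_mul_I
  split_ifs at h₁ h₂ <;>
    simp only [Complex.star_def, map_one, one_mul, Complex.conj_I, neg_mul, mul_neg, neg_neg, hm]
      at h₁ h₂ <;>
    first
    | exact hI _ h₁
    | exact hI' _ h₁
    | exact hn _ h₁
    | exact hI _ h₂
    | exact hI' _ h₂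
    | exact hn _ h₂
    | (exfalso; grind)

theorem rotation (hT : UnitaryInvariantTensor T) {p q : n} (hpq : p ≠ q) :
    T p p p p = T p q p q + T p q q p := by
  set v : n → ℂ := Pi.single p 1 - Pi.single q 2 with hv
  have hvv : v ⬝ᵥ v = 5 := by
    simp [hv, hpq, hpq.symm, dotProduct_sub]
    norm_num
  have hsv : star v = v := by
    ext i
    simp [hv, Pi.single_apply, apply_ite (starRingEnd ℂ), Complex.conj_ofNat]
  have hV : (1 - (2 / 5 : ℂ) • Matrix.vecMulVec v v) ∈ Matrix.unitaryGroup n ℂ := by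
    have hs : star (1 - (2 / 5 : ℂ) • Matrix.vecMulVec v v)
        = 1 - (2 / 5 : ℂ) • Matrix.vecMulVec v v := by
      simp [Matrix.star_eq_conjTranspose, Matrix.conjTranspose_vecMulVec, hsv]
    rw [Matrix.mem_unitaryGroup_iff, hs]
    simp only [sub_mul, mul_sub, one_mul, mul_one, Matrix.smul_mul, Matrix.mul_smul,
      Matrix.vecMulVec_mul_vecMulVec, hvv, Matrix.vecMulVec_smul]
    module
  have hrow : ∀ a, (1 - (2 / 5 : ℂ) • Matrix.vecMulVec v v) p a
      = (if p = a then 3 / 5 else 0) + (if q = a then 4 / 5 else 0) := fun a => by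
    simp only [Matrix.sub_apply, Matrix.smul_apply, Matrix.vecMulVec_apply, Matrix.one_apply, hv,
      Pi.sub_apply, Pi.single_apply, smul_eq_mul]
    by_cases h : p = a
    · subst h
      simp [hpq, hpq.symm]; norm_num
    · by_cases h' : q = a
      · subst h'
        simp [hpq, hpq.symm]; norm_num
      · simp [h, h', Ne.symm h, Ne.symm h', hpq]
  have key := hT _ hV p p p p
  simp only [hrow, star_add, apply_ite star, star_zero, ite_mul, zero_mul, add_mul,
    Finset.sum_add_distrib, Finset.sum_ite_eq, Finset.mem_univ, if_true] at key
  have hz : ∀ {a b c d : n}, _ → _ → T a b c d = 0 := fun h h' => hT.eq_zero h h'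
  have h3 : star (3 / 5 : ℂ) = 3 / 5 := by simp
  have h4 : star (4 / 5 : ℂ) = 4 / 5 := by simp
  have s₀ := hT.eq_perm (Equiv.swap p q) q q q q
  have s₁ := hT.eq_perm (Equiv.swap p q) q p q p
  have s₂ := hT.eq_perm (Equiv.swap p q) q p p q
  simp only [Equiv.swap_apply_left, Equiv.swap_apply_right] at s₀ s₁ s₂
  rw [h3, h4, s₀, s₁, s₂, hz (a := p) (b := p) (c := p) (d := q),
    hz (a := p) (b := p) (c := q) (d := p),
    hz (a := p) (b := p) (c := q) (d := q), hz (a := p) (b := q) (c := p) (d := p),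
    hz (a := p) (b := q) (c := q) (d := q), hz (a := q) (b := p) (c := p) (d := p),
    hz (a := q) (b := p) (c := q) (d := q), hz (a := q) (b := q) (c := p) (d := p),
    hz (a := q) (b := q) (c := p) (d := q), hz (a := q) (b := q) (c := q) (d := p)] at key
  · linear_combination (625 / 288) * key
  all_goals simp [hpq, hpq.symm]

/-- Invariant tensors are combinations of the two permutation tensors. -/
theorem exists_eq [Nontrivial n] (hT : UnitaryInvariantTensor T) :
    ∃ a b : ℂ, ∀ i₁ i₂ k₁ k₂, T i₁ i₂ k₁ k₂ =
      a * (kdelta i₁ k₁ * kdelta i₂ k₂) + b * (kdelta i₁ k₂ * kdelta i₂ k₁) := by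
  obtain ⟨p, q, hpq⟩ := exists_pair_ne n
  have hoff : ∀ r s : n, r ≠ s → T r s r s = T p q p q ∧ T r s s r = T p q q p := by
    intro r s hrs
    obtain ⟨σ, rfl, rfl⟩ := exists_perm_pair hpq hrs
    exact ⟨(hT.eq_perm σ p q p q).symm, (hT.eq_perm σ p q q p).symm⟩
  refine ⟨T p q p q, T p q q p, fun i₁ i₂ k₁ k₂ => ?_⟩
  unfold kdelta
  by_cases h : i₁ = k₁ ∧ i₂ = k₂
  · obtain ⟨rfl, rfl⟩ := h
    by_cases h : i₁ = i₂
    · subst h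
      obtain ⟨s, hs⟩ := exists_ne i₁
      rw [hT.rotation hs.symm, (hoff _ _ hs.symm).1, (hoff _ _ hs.symm).2]
      simp
    · simp [h, (hoff _ _ h).1]
  · by_cases h' : i₁ = k₂ ∧ i₂ = k₁
    · obtain ⟨rfl, rfl⟩ := h'
      have h' : i₁ ≠ i₂ := fun e => h ⟨e, e.symm⟩
      simp [h', (hoff _ _ h').2]
    · rw [hT.eq_zero h h']
      have e : ∀ {x y z w : n}, ¬(x = y ∧ z = w) →
          (if x = y then (1 : ℂ) else 0) * (if z = w then 1 else 0) = 0 := fun h => by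
        rw [ite_zero_mul_ite_zero, if_neg h]
      rw [e h, e h', mul_zero, mul_zero, add_zero]

end UnitaryInvariantTensor

section Moment

variable {n : Type*} [Fintype n] [DecidableEq n]

/-- The mixed second moment of the entries of a random unitary matrix. -/
noncomputable def unitaryMoment (μ : Measure (Matrix.unitaryGroup n ℂ))
    (j₁ j₂ l₁ l₂ i₁ i₂ k₁ k₂ : n) : ℂ :=
  ∫ U : Matrix.unitaryGroup n ℂ, (U : Matrix n n ℂ) i₁ j₁ * (U : Matrix n n ℂ) i₂ j₂ *
    (starRingEnd ℂ) ((U : Matrix n n ℂ) k₁ l₁) * (starRingEnd ℂ) ((U : Matrix n n ℂ) k₂ l₂) ∂μ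

variable (μ : Measure (Matrix.unitaryGroup n ℂ)) [IsProbabilityMeasure μ] (j₁ j₂ l₁ l₂ : n)

theorem integrable_unitaryMoment (i₁ i₂ k₁ k₂ : n) :
    Integrable (fun U : Matrix.unitaryGroup n ℂ => (U : Matrix n n ℂ) i₁ j₁ *
      (U : Matrix n n ℂ) i₂ j₂ * (starRingEnd ℂ) ((U : Matrix n n ℂ) k₁ l₁) *
      (starRingEnd ℂ) ((U : Matrix n n ℂ) k₂ l₂)) μ := by
  have hc : ∀ i j : n, Continuous fun U : Matrix.unitaryGroup n ℂ => (U : Matrix n n ℂ) i j :=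
    fun i j => continuous_subtype_val.matrix_elem i j
  refine Integrable.of_bound (C := 1) (Continuous.aestronglyMeasurable ?_) ?_
  · exact (((hc _ _).mul (hc _ _)).mul (Complex.continuous_conj.comp (hc _ _))).mul
      (Complex.continuous_conj.comp (hc _ _))
  · refine Filter.Eventually.of_forall fun U => ?_
    have hb : ∀ i j : n, ‖(U : Matrix n n ℂ) i j‖ ≤ 1 :=
      fun i j => entry_norm_bound_of_unitary U.2 i j
    simp only [norm_mul, RCLike.norm_conj]
    have h₁ := mul_le_one₀ (hb i₁ j₁) (norm_nonneg _) (hb i₂ j₂)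
    have h₂ := mul_le_one₀ h₁ (norm_nonneg _) (hb k₁ l₁)
    exact mul_le_one₀ h₂ (norm_nonneg _) (hb k₂ l₂)

theorem unitaryInvariantTensor_unitaryMoment [μ.IsMulLeftInvariant] :
    UnitaryInvariantTensor (unitaryMoment μ j₁ j₂ l₁ l₂) := by
  intro V hV i₁ i₂ k₁ k₂
  unfold unitaryMoment
  rw [← integral_mul_left_eq_self _ (⟨V, hV⟩ : Matrix.unitaryGroup n ℂ)]
  simp only [← integral_const_mul]
  have hint := integrable_unitaryMoment μ j₁ j₂ l₁ l₂
  have h₁ := fun a b c d => (hint a b c d).const_mul (star (V k₂ d))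
  have h₂ := fun a b c => (integrable_finsetSum Finset.univ fun d _ => h₁ a b c d)
  have h₃ := fun a b c => (h₂ a b c).const_mul (star (V k₁ c))
  have h₄ := fun a b => (integrable_finsetSum Finset.univ fun c _ => h₃ a b c)
  have h₅ := fun a b => (h₄ a b).const_mul (V i₂ b)
  have h₆ := fun a => (integrable_finsetSum Finset.univ fun b _ => h₅ a b)
  have h₇ := fun a => (h₆ a).const_mul (V i₁ a)
  simp_rw [← integral_finsetSum _ fun d _ => h₁ _ _ _ d, ← integral_const_mul,
    ← integral_finsetSum _ fun c _ => h₃ _ _ c, ← integral_const_mul,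
    ← integral_finsetSum _ fun b _ => h₅ _ b, ← integral_const_mul,
    ← integral_finsetSum _ fun a _ => h₇ a]
  refine integral_congr_ae (Filter.Eventually.of_forall fun U => ?_)
  simp only [Submonoid.coe_mul, Matrix.mul_apply, map_sum, map_mul, mul_assoc, Finset.sum_mul]
  simp only [Finset.mul_sum, starRingEnd_apply]
  refine Finset.sum_congr rfl fun a _ => Finset.sum_congr rfl fun b _ =>
    Finset.sum_congr rfl fun c _ => Finset.sum_congr rfl fun d _ => by ring

theorem sum_entry_mul_conj (U : Matrix.unitaryGroup n ℂ) (j l : n) :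
    ∑ i, (U : Matrix n n ℂ) i j * (starRingEnd ℂ) ((U : Matrix n n ℂ) i l) = kdelta j l := by
  have h := congrFun (congrFun (Matrix.mem_unitaryGroup_iff'.1 U.2) l) j
  simp only [Matrix.mul_apply, Matrix.star_apply, Matrix.one_apply] at h
  simpa [kdelta, mul_comm, eq_comm] using h

theorem sum_unitaryMoment_parallel :
    ∑ a, ∑ b, unitaryMoment μ j₁ j₂ l₁ l₂ a b a b = kdelta j₁ l₁ * kdelta j₂ l₂ := by
  unfold unitaryMoment
  have hint := integrable_unitaryMoment μ j₁ j₂ l₁ l₂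
  simp_rw [← integral_finsetSum _ fun b _ => hint _ b _ b]
  rw [← integral_finsetSum _ fun a _ => integrable_finsetSum _ fun b _ => hint a b a b]
  have h : ∀ U : Matrix.unitaryGroup n ℂ, ∑ a, ∑ b, ((U : Matrix n n ℂ) a j₁ *
      (U : Matrix n n ℂ) b j₂ * (starRingEnd ℂ) ((U : Matrix n n ℂ) a l₁) *
      (starRingEnd ℂ) ((U : Matrix n n ℂ) b l₂)) = kdelta j₁ l₁ * kdelta j₂ l₂ := fun U => by
    rw [← sum_entry_mul_conj U, ← sum_entry_mul_conj U, Finset.sum_mul_sum]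
    exact Finset.sum_congr rfl fun a _ => Finset.sum_congr rfl fun b _ => by ring
  simp [h]

theorem sum_unitaryMoment_crossed :
    ∑ a, ∑ b, unitaryMoment μ j₁ j₂ l₁ l₂ a b b a = kdelta j₁ l₂ * kdelta j₂ l₁ := by
  rw [← sum_unitaryMoment_parallel μ]
  refine Finset.sum_congr rfl fun a _ => Finset.sum_congr rfl fun b _ => ?_
  unfold unitaryMoment
  exact integral_congr_ae (Filter.Eventually.of_forall fun U => by ring)

end Moment

theorem weingarten_second_moment
    (N : ℕ) (hN : 2 ≤ N)
    (μ : Measure (Matrix.unitaryGroup (Fin N) ℂ))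
    (hprob : IsProbabilityMeasure μ) (hinv : μ.IsMulLeftInvariant)
    (i₁ i₂ j₁ j₂ k₁ k₂ l₁ l₂ : Fin N) :
    (∫ U : Matrix.unitaryGroup (Fin N) ℂ,
        (U : Matrix (Fin N) (Fin N) ℂ) i₁ j₁ * (U : Matrix (Fin N) (Fin N) ℂ) i₂ j₂ *
          (starRingEnd ℂ) ((U : Matrix (Fin N) (Fin N) ℂ) k₁ l₁) *
          (starRingEnd ℂ) ((U : Matrix (Fin N) (Fin N) ℂ) k₂ l₂) ∂μ) =
      (1 / ((N : ℂ) ^ 2 - 1)) *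
          (kdelta i₁ k₁ * kdelta i₂ k₂ * kdelta j₁ l₁ * kdelta j₂ l₂ +
            kdelta i₁ k₂ * kdelta i₂ k₁ * kdelta j₁ l₂ * kdelta j₂ l₁) -
        (1 / ((N : ℂ) * ((N : ℂ) ^ 2 - 1))) *
          (kdelta i₁ k₁ * kdelta i₂ k₂ * kdelta j₁ l₂ * kdelta j₂ l₁ +
            kdelta i₁ k₂ * kdelta i₂ k₁ * kdelta j₁ l₁ * kdelta j₂ l₂) := by
  have : Nontrivial (Fin N) := Fin.nontrivial_iff_two_le.2 hN
  obtain ⟨a, b, h⟩ := (unitaryInvariantTensor_unitaryMoment μ j₁ j₂ l₁ l₂).exists_eq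
  have hp := sum_unitaryMoment_parallel μ j₁ j₂ l₁ l₂
  have hc := sum_unitaryMoment_crossed μ j₁ j₂ l₁ l₂
  have hdd : ∀ x y : Fin N, kdelta x y * kdelta y x = kdelta x y := fun x y => by
    by_cases e : x = y <;> simp [kdelta, e]
  have hd : ∀ x : Fin N, kdelta x x = 1 := fun x => if_pos rfl
  have hs : ∀ x : Fin N, ∑ y, kdelta x y = 1 := fun x => by simp [kdelta]
  simp only [h, hdd, hd, Finset.sum_add_distrib, ← Finset.mul_sum, hs, Finset.sum_const,
    Finset.card_univ, Fintype.card_fin, nsmul_eq_mul, mul_one] at hp hc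
  have hN0 : (N : ℂ) ≠ 0 := by exact_mod_cast (by omega : N ≠ 0)
  have hN1 : (N : ℂ) ^ 2 - 1 ≠ 0 := sub_ne_zero.2 (by exact_mod_cast (by nlinarith : N ^ 2 ≠ 1))
  refine (h i₁ i₂ k₁ k₂).trans ?_
  have ha : a = (N * (kdelta j₁ l₁ * kdelta j₂ l₂) - kdelta j₁ l₂ * kdelta j₂ l₁) /
      (N * ((N : ℂ) ^ 2 - 1)) := by
    rw [eq_div_iff (mul_ne_zero hN0 hN1), ← hp, ← hc]
    ring
  have hb : b = (N * (kdelta j₁ l₂ * kdelta j₂ l₁) - kdelta j₁ l₁ * kdelta j₂ l₂) /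
      (N * ((N : ℂ) ^ 2 - 1)) := by
    rw [eq_div_iff (mul_ne_zero hN0 hN1), ← hp, ← hc]
    ring
  rw [ha, hb]
  field_simp
  ring
end

section
/- Maximal entanglement growth in dual-unitary circuits from Bell-pair states: consider a ring of 2L qudits of local dimension d (sites 1,…,2L cyclically) with brickwork Floquet operator 𝕌 = 𝕌_e 𝕌_o, where 𝕌_o is a tensor product of two-site gates on the pairs (1,2),(3,4),…,(2L−1,2L) and 𝕌_e on the pairs (2,3),(4,5),…,(2L,1), all gates being dual-unitary (both each gate and its reshuffle are unitary; the gates may depend on position). Let the initial state be the product of Bell pairs on the 𝕌_e-bonds: |Ψ_0⟩ = ⊗ over the pairs (2,3),(4,5),…,(2L,1) of d^{−1/2} Σ_{i=1}^d |i⟩⊗|i⟩. Let t ∈ ℕ, |Ψ_t⟩ = 𝕌^t |Ψ_0⟩, and let A = {2a+1, 2a+2, …, 2a+2m} be a contiguous block of 2m sites whose two endpoints each cut through a Bell pair, with m + 2t + 1 ≤ L. Then for every integer n ≥ 2 the reduced density matrix ρ_A(t) = tr_{Ā}[|Ψ_t⟩⟨Ψ_t|] satisfies tr[ρ_A(t)^n]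 = d^{−2(n−1) min(2t+1, m)}; equivalently, the Rényi entropies are S^{(n)}_A(t) = 2 min(2t+1, m) log d. -/
/- Maximal entanglement growth in dual-unitary brickwork circuits prepared in a
product of Bell pairs on the even bonds. -/

/-- Configurations of `n` qudits of local dimension `d`. -/
abbrev Cfg (d n : ℕ) := Fin n → Fin d

/-- The site `x mod n` of a ring of `n` sites. -/
def site (n : ℕ) (hn : 0 < n) (x : ℕ) : Fin n := ⟨x % n, Nat.mod_lt x hn⟩

/-- The reshuffle (space-time swap) of a two-site gate:
`Ũ_{(i,j),(k,l)} = U_{(j,l),(i,k)}`. -/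
def reshuffle {d : ℕ} (U : Matrix (Fin d × Fin d) (Fin d × Fin d) ℂ) :
    Matrix (Fin d × Fin d) (Fin d × Fin d) ℂ :=
  fun p q => U (p.2, q.2) (p.1, q.1)

/-- The layer of two-site gates applied on the pairs `(1,2), (3,4), …, (2L−1,2L)`. -/
noncomputable def oddLayer (d L : ℕ) (hL : 0 < L)
    (U : Fin L → Matrix (Fin d × Fin d) (Fin d × Fin d) ℂ) :
    Matrix (Cfg d (2 * L)) (Cfg d (2 * L)) ℂ :=
  fun f g => ∏ k : Fin L,
    U k (f (site (2 * L) (by omega) (2 * k.val)), f (site (2 * L) (by omega) (2 * k.val + 1)))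
        (g (site (2 * L) (by omega) (2 * k.val)), g (site (2 * L) (by omega) (2 * k.val + 1)))

/-- The layer of two-site gates applied on the pairs `(2,3), (4,5), …, (2L,1)`. -/
noncomputable def evenLayer (d L : ℕ) (hL : 0 < L)
    (U : Fin L → Matrix (Fin d × Fin d) (Fin d × Fin d) ℂ) :
    Matrix (Cfg d (2 * L)) (Cfg d (2 * L)) ℂ :=
  fun f g => ∏ k : Fin L,
    U k (f (site (2 * L) (by omega) (2 * k.val + 1)), f (site (2 * L) (by omega) (2 * k.val + 2)))
        (g (site (2 * L) (by omega) (2 * k.val + 1)), g (site (2 * L) (by omega) (2 * k.val + 2)))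

/-- The reduced density matrix of the pure state `Ψ` on the block `A`. -/
noncomputable def rho {n : ℕ} {α : Type} [Fintype α] [DecidableEq α]
    (A : Finset (Fin n)) (Ψ : (Fin n → α) → ℂ) :
    Matrix ({ j // j ∈ A } → α) ({ j // j ∈ A } → α) ℂ :=
  fun u v => ∑ w : { j // j ∉ A } → α,
    Ψ (fun j => if hj : j ∈ A then u ⟨j, hj⟩ else w ⟨j, hj⟩) *
      (starRingEnd ℂ) (Ψ (fun j => if hj : j ∈ A then v ⟨j, hj⟩ else w ⟨j, hj⟩))

/-- The product of Bell pairs on the even bonds `(2,3), (4,5), …, (2L,1)`: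
`Ψ₀ = ⊗ (d^{-1/2} Σ_i |i⟩ ⊗ |i⟩)`. -/
noncomputable def bellState (d L : ℕ) (hL : 0 < L) : Cfg d (2 * L) → ℂ :=
  fun f => (((Real.sqrt d : ℂ))⁻¹) ^ L *
    (if ∀ k : Fin L, f (site (2 * L) (by omega) (2 * k.val + 1)) =
        f (site (2 * L) (by omega) (2 * k.val + 2)) then 1 else 0)

open Matrix

section Pairing

variable {ι κ : Type*} [Fintype ι] [DecidableEq ι] [Fintype κ] [DecidableEq κ] {d : ℕ}

/-- The conditional expectation replacing the sites of `S` by the maximally mixed state. -/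
noncomputable def depol (S : Finset ι) :
    Matrix (ι → Fin d) (ι → Fin d) ℂ →ₗ[ℂ] Matrix (ι → Fin d) (ι → Fin d) ℂ where
  toFun O := Matrix.of fun f g =>
    if ∀ j ∈ S, f j = g j then
      (Fintype.card (ι → Fin d) : ℂ)⁻¹ * ∑ h, O (S.piecewise h f) (S.piecewise h g) else 0
  map_add' O O' := by
    ext f g
    simp only [Matrix.of_apply, Matrix.add_apply, Finset.sum_add_distrib]
    split_ifs <;> ring
  map_smul' c O := by
    ext f g
    simp only [Matrix.of_apply, Matrix.smul_apply, smul_eq_mul, ← Finset.mul_sum,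
      RingHom.id_apply]
    split_ifs <;> ring

/-- The two-site version of `depol`, where `a` and `b` say which of the sites are replaced. -/
noncomputable def pairDepol (a b : Prop) [Decidable a] [Decidable b]
    (o : Matrix (Fin d × Fin d) (Fin d × Fin d) ℂ) :
    Matrix (Fin d × Fin d) (Fin d × Fin d) ℂ :=
  Matrix.of fun p q =>
    if (a → p.1 = q.1) ∧ (b → p.2 = q.2) then
      (Fintype.card (Fin d × Fin d) : ℂ)⁻¹ * ∑ h : Fin d × Fin d,
        o (if a then h.1 else p.1, if b then h.2 else p.2)
          (if a then h.1 else q.1, if b then h.2 else q.2) else 0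

/-- The tensor product of two-site operators over the pairs `(l k, r k)`. -/
noncomputable def pairTensor (l r : κ → ι)
    (o : κ → Matrix (Fin d × Fin d) (Fin d × Fin d) ℂ) :
    Matrix (ι → Fin d) (ι → Fin d) ℂ :=
  Matrix.of fun f g => ∏ k, o k (f (l k), f (r k)) (g (l k), g (r k))

variable {l r : κ → ι}

omit [Fintype κ] [DecidableEq κ] [Fintype ι] [DecidableEq ι] in
lemma forall_site_iff (hb : Function.Bijective (Sum.elim l r)) {P : ι → Prop} :
    (∀ j, P j) ↔ ∀ k, P (l k) ∧ P (r k) := by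
  rw [hb.surjective.forall (p := P)]
  simp [Sum.forall, forall_and]

omit [Fintype κ] [DecidableEq κ] [Fintype ι] [DecidableEq ι] in
lemma cfg_eq_iff (hb : Function.Bijective (Sum.elim l r)) {f g : ι → Fin d} :
    f = g ↔ ∀ k, (f (l k), f (r k)) = (g (l k), g (r k)) := by
  simp only [funext_iff, Prod.mk.injEq]
  exact forall_site_iff hb

lemma sum_prod_pairs (hb : Function.Bijective (Sum.elim l r)) (F : κ → Fin d × Fin d → ℂ) :
    ∑ h : ι → Fin d, ∏ k, F k (h (l k), h (r k)) = ∏ k, ∑ p, F k p := by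
  rw [Fintype.prod_sum]
  refine Fintype.sum_bijective (fun h k => (h (l k), h (r k))) ?_ _ _ fun _ => rfl
  refine ⟨fun f g h => (cfg_eq_iff hb).2 (congrFun h), fun G => ?_⟩
  let e := Equiv.ofBijective _ hb
  refine ⟨fun j => Sum.elim (fun k => (G k).1) (fun k => (G k).2) (e.symm j), ?_⟩
  have hl : ∀ k, e.symm (l k) = Sum.inl k := fun k => e.symm_apply_eq.2 rfl
  have hr : ∀ k, e.symm (r k) = Sum.inr k := fun k => e.symm_apply_eq.2 rfl
  ext k <;> simp [hl, hr]

lemma pairTensor_mul (hb : Function.Bijective (Sum.elim l r))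
    (o o' : κ → Matrix (Fin d × Fin d) (Fin d × Fin d) ℂ) :
    pairTensor l r o * pairTensor l r o' = pairTensor l r fun k => o k * o' k := by
  ext f g
  simp only [pairTensor, Matrix.mul_apply, Matrix.of_apply, ← Finset.prod_mul_distrib]
  exact sum_prod_pairs hb fun k p => o k (f (l k), f (r k)) p * o' k p (g (l k), g (r k))

omit [DecidableEq κ] [Fintype ι] [DecidableEq ι] in
lemma conjTranspose_pairTensor (o : κ → Matrix (Fin d × Fin d) (Fin d × Fin d) ℂ) :
    (pairTensor l r o)ᴴ = pairTensor l r fun k => (o k)ᴴ := by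
  ext f g
  simp [pairTensor, Matrix.conjTranspose_apply]

omit [DecidableEq κ] [DecidableEq ι] in
lemma pairTensor_single (hb : Function.Bijective (Sum.elim l r)) (f g : ι → Fin d) :
    pairTensor l r (fun k => Matrix.single (f (l k), f (r k)) (g (l k), g (r k)) 1) =
      Matrix.single f g 1 := by
  ext f' g'
  simp only [pairTensor, Matrix.of_apply, Matrix.single_apply, Finset.prod_ite_zero,
    Finset.prod_const_one, Finset.mem_univ, true_imp_iff, forall_and, ← cfg_eq_iff hb]

omit [DecidableEq κ] [DecidableEq ι] in
lemma pairTensor_one (hb : Function.Bijective (Sum.elim l r)) :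
    pairTensor l r (fun _ => (1 : Matrix (Fin d × Fin d) (Fin d × Fin d) ℂ)) = 1 := by
  ext f g
  simp only [pairTensor, Matrix.of_apply, Matrix.one_apply, Finset.prod_ite_zero,
    Finset.prod_const_one, Finset.mem_univ, true_imp_iff, ← cfg_eq_iff hb]

lemma trace_pairTensor (hb : Function.Bijective (Sum.elim l r))
    (o : κ → Matrix (Fin d × Fin d) (Fin d × Fin d) ℂ) :
    (pairTensor l r o).trace = ∏ k, (o k).trace :=
  sum_prod_pairs hb fun k p => o k p p

lemma pairTensor_mem_unitaryGroup (hb : Function.Bijective (Sum.elim l r))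
    {U : κ → Matrix (Fin d × Fin d) (Fin d × Fin d) ℂ}
    (hU : ∀ k, U k ∈ Matrix.unitaryGroup (Fin d × Fin d) ℂ) :
    pairTensor l r U ∈ Matrix.unitaryGroup (ι → Fin d) ℂ := by
  rw [Matrix.mem_unitaryGroup_iff, Matrix.star_eq_conjTranspose, conjTranspose_pairTensor,
    pairTensor_mul hb, ← pairTensor_one hb]
  congr 1
  ext1 k
  exact Matrix.mem_unitaryGroup_iff.1 (hU k)

lemma depol_pairTensor (hb : Function.Bijective (Sum.elim l r)) (S : Finset ι)
    (o : κ → Matrix (Fin d × Fin d) (Fin d × Fin d) ℂ) :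
    depol S (pairTensor l r o) =
      pairTensor l r fun k => pairDepol (l k ∈ S) (r k ∈ S) (o k) := by
  have hcard : (Fintype.card (ι → Fin d) : ℂ) =
      ∏ _k : κ, (Fintype.card (Fin d × Fin d) : ℂ) := by
    have := sum_prod_pairs (d := d) hb (fun _ _ => (1 : ℂ))
    simpa [-Fintype.card_pi, -Fintype.card_prod] using this
  ext f g
  simp only [depol, pairDepol, pairTensor, LinearMap.coe_mk, AddHom.coe_mk, Matrix.of_apply,
    Finset.prod_ite_zero, Finset.mem_univ, true_imp_iff, Finset.prod_mul_distrib, hcard,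
    Finset.prod_inv_distrib, Finset.piecewise]
  refine if_congr (forall_site_iff hb) (congrArg _ ?_) rfl
  exact sum_prod_pairs hb fun k h =>
    o k (if l k ∈ S then h.1 else f (l k), if r k ∈ S then h.2 else f (r k))
      (if l k ∈ S then h.1 else g (l k), if r k ∈ S then h.2 else g (r k))

omit [DecidableEq κ] [DecidableEq ι] in
lemma linearMap_ext_pairTensor (hb : Function.Bijective (Sum.elim l r))
    {Φ Ψ : Matrix (ι → Fin d) (ι → Fin d) ℂ →ₗ[ℂ] Matrix (ι → Fin d) (ι → Fin d) ℂ}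
    (h : ∀ o, Φ (pairTensor l r o) = Ψ (pairTensor l r o)) : Φ = Ψ := by
  refine Matrix.ext_linearMap _ fun f g => LinearMap.ext_ring ?_
  simpa [pairTensor_single hb] using
    h fun k => Matrix.single (f (l k), f (r k)) (g (l k), g (r k)) 1

end Pairing

section Pair

variable {d : ℕ}

lemma pairDepol_neither {a b : Prop} [Decidable a] [Decidable b] (hd : d ≠ 0) (ha : ¬a) (hb : ¬b)
    (o : Matrix (Fin d × Fin d) (Fin d × Fin d) ℂ) : pairDepol a b o = o := by
  ext p q
  simp only [pairDepol, ha, hb, Matrix.of_apply]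
  simp
  field_simp

lemma pairDepol_both {a b : Prop} [Decidable a] [Decidable b] (ha : a) (hb : b)
    (o : Matrix (Fin d × Fin d) (Fin d × Fin d) ℂ) :
    pairDepol a b o = ((d : ℂ) ^ 2)⁻¹ • o.trace • 1 := by
  ext p q
  simp [pairDepol, ha, hb, Matrix.one_apply, Prod.ext_iff, Matrix.trace, sq]

lemma pairDepol_left {a b : Prop} [Decidable a] [Decidable b] (hd : d ≠ 0) (ha : a) (hb : ¬b)
    (o : Matrix (Fin d × Fin d) (Fin d × Fin d) ℂ) (p q : Fin d × Fin d) :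
    pairDepol a b o p q =
      if p.1 = q.1 then (d : ℂ)⁻¹ * ∑ i, o (i, p.2) (i, q.2) else 0 := by
  simp only [pairDepol, ha, hb, Matrix.of_apply, Fintype.sum_prod_type]
  simp [← Finset.mul_sum, mul_assoc, hd]

lemma pairDepol_right {a b : Prop} [Decidable a] [Decidable b] (hd : d ≠ 0) (ha : ¬a) (hb : b)
    (o : Matrix (Fin d × Fin d) (Fin d × Fin d) ℂ) (p q : Fin d × Fin d) :
    pairDepol a b o p q =
      if p.2 = q.2 then (d : ℂ)⁻¹ * ∑ i, o (p.1, i) (q.1, i) else 0 := by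
  simp only [pairDepol, ha, hb, Matrix.of_apply, Fintype.sum_prod_type]
  simp [hd, mul_assoc]

lemma trace_pairDepol {a b : Prop} [Decidable a] [Decidable b] (hd : d ≠ 0)
    (o : Matrix (Fin d × Fin d) (Fin d × Fin d) ℂ) :
    (pairDepol a b o).trace = o.trace := by
  by_cases ha : a <;> by_cases hb : b
  · simp [pairDepol_both ha hb, hd, Matrix.trace_one, ← sq, mul_comm]
  · simp only [Matrix.trace, Matrix.diag, pairDepol_left hd ha hb, Fintype.sum_prod_type, if_true]
    rw [Finset.sum_comm]
    simp [hd]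
    rw [Finset.sum_comm]
  · simp only [Matrix.trace, Matrix.diag, pairDepol_right hd ha hb, Fintype.sum_prod_type, if_true]
    simp [hd]
  · rw [pairDepol_neither hd ha hb]

lemma sum_comm_four {α : Type*} [Fintype α] (F : α → α → α → α → ℂ) :
    ∑ i, ∑ c, ∑ y', ∑ y, F i c y' y = ∑ y', ∑ y, ∑ i, ∑ c, F i c y' y := by
  calc _ = ∑ p : α × α, ∑ q : α × α, F p.1 p.2 q.1 q.2 := by simp [Fintype.sum_prod_type]
    _ = ∑ q : α × α, ∑ p : α × α, F p.1 p.2 q.1 q.2 := Finset.sum_comm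
    _ = _ := by simp [Fintype.sum_prod_type]

lemma trace_unitary_conj {n : Type*} [Fintype n] [DecidableEq n] {U : Matrix n n ℂ}
    (hU : U ∈ Matrix.unitaryGroup n ℂ) (o : Matrix n n ℂ) : (U * o * Uᴴ).trace = o.trace := by
  rw [Matrix.trace_mul_cycle, ← Matrix.star_eq_conjTranspose, Matrix.mem_unitaryGroup_iff'.1 hU,
    one_mul]

lemma unitary_conj_pairDepol_both {a b : Prop} [Decidable a] [Decidable b] (ha : a) (hb : b)
    {U : Matrix (Fin d × Fin d) (Fin d × Fin d) ℂ}
    (hU : U ∈ Matrix.unitaryGroup (Fin d × Fin d) ℂ)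
    (o : Matrix (Fin d × Fin d) (Fin d × Fin d) ℂ) :
    U * pairDepol a b o * Uᴴ = pairDepol a b o := by
  have : U * Uᴴ = 1 := Matrix.mem_unitaryGroup_iff.1 hU
  simp [pairDepol_both ha hb, this]

lemma pairDepol_left_conj {a b a' b' : Prop} [Decidable a] [Decidable b] [Decidable a']
    [Decidable b'] (hd : d ≠ 0) (ha : a) (hb : ¬b) (ha' : a') (hb' : b')
    {U : Matrix (Fin d × Fin d) (Fin d × Fin d) ℂ}
    (hU : reshuffle U ∈ Matrix.unitaryGroup (Fin d × Fin d) ℂ)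
    (o : Matrix (Fin d × Fin d) (Fin d × Fin d) ℂ) :
    pairDepol a b (U * pairDepol a b o * Uᴴ) = pairDepol a' b' o := by
  have key : ∀ x y x' y' : Fin d, ∑ h, ∑ c, U (h, x) (c, y) * star (U (h, x') (c, y')) =
      if x = x' ∧ y = y' then 1 else 0 := by
    intro x y x' y'
    have := congrFun₂ (Matrix.mem_unitaryGroup_iff'.1 hU) (y', x') (y, x)
    simp only [Matrix.mul_apply, Matrix.star_apply, reshuffle, Fintype.sum_prod_type,
      Matrix.one_apply, Prod.mk.injEq] at this
    rw [Finset.sum_comm]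
    simp only [mul_comm (U _ _), this]
    exact if_congr (by tauto) rfl rfl
  ext p q
  have conj_sum : ∑ i, (U * pairDepol a b o * Uᴴ) (i, p.2) (i, q.2) =
      if p.2 = q.2 then (d : ℂ)⁻¹ * o.trace else 0 := by
    calc ∑ i, (U * pairDepol a b o * Uᴴ) (i, p.2) (i, q.2)
        = ∑ i, ∑ c, ∑ y', ∑ y, ((d : ℂ)⁻¹ * ∑ j, o (j, y) (j, y')) *
            (U (i, p.2) (c, y) * star (U (i, q.2) (c, y'))) := by
          simp only [Matrix.mul_apply, Fintype.sum_prod_type, pairDepol_left hd ha hb,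
            Matrix.conjTranspose_apply, mul_ite, mul_zero]
          refine Finset.sum_congr rfl fun i _ => Finset.sum_congr rfl fun c _ =>
            Finset.sum_congr rfl fun y' _ => ?_
          rw [Finset.sum_comm, Finset.sum_mul]
          refine Finset.sum_congr rfl fun y _ => ?_
          rw [Finset.sum_ite_eq' Finset.univ c]
          simp only [Finset.mem_univ, if_true]
          ring
      _ = ∑ y', ∑ y, ((d : ℂ)⁻¹ * ∑ j, o (j, y) (j, y')) *
            ∑ i, ∑ c, (U (i, p.2) (c, y) * star (U (i, q.2) (c, y'))) := by
          simp only [Finset.mul_sum (Finset.univ : Finset (Fin d)) _ ((d : ℂ)⁻¹ * _)]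
          rw [sum_comm_four]
      _ = _ := by
          simp only [key, mul_ite, mul_one, mul_zero, ite_and, Matrix.trace, Matrix.diag,
            Fintype.sum_prod_type]
          split_ifs
          · rw [Finset.sum_comm (s := (Finset.univ : Finset (Fin d)))]
            simp [Finset.mul_sum]
            rw [Finset.sum_comm]
          · simp
  rw [pairDepol_left hd ha hb, pairDepol_both ha' hb', conj_sum, Matrix.smul_apply,
    Matrix.smul_apply, Matrix.one_apply]
  simp only [Prod.ext_iff, ite_and, smul_eq_mul]
  split_ifs <;> simp [sq, mul_assoc]

lemma pairDepol_right_conj {a b a' b' : Prop} [Decidable a] [Decidable b] [Decidable a']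
    [Decidable b'] (hd : d ≠ 0) (ha : ¬a) (hb : b) (ha' : a') (hb' : b')
    {U : Matrix (Fin d × Fin d) (Fin d × Fin d) ℂ}
    (hU : reshuffle U ∈ Matrix.unitaryGroup (Fin d × Fin d) ℂ)
    (o : Matrix (Fin d × Fin d) (Fin d × Fin d) ℂ) :
    pairDepol a b (U * pairDepol a b o * Uᴴ) = pairDepol a' b' o := by
  have key : ∀ x y x' y' : Fin d, ∑ h, ∑ c, U (x, h) (y, c) * star (U (x', h) (y', c)) =
      if x = x' ∧ y = y' then 1 else 0 := by
    intro x y x' y'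
    have := congrFun₂ (Matrix.mem_unitaryGroup_iff.1 hU) (y, x) (y', x')
    simp only [Matrix.mul_apply, Matrix.star_apply, reshuffle, Fintype.sum_prod_type,
      Matrix.one_apply, Prod.mk.injEq] at this
    rw [Finset.sum_comm]
    simp only [this]
    exact if_congr (by tauto) rfl rfl
  ext p q
  have conj_sum : ∑ i, (U * pairDepol a b o * Uᴴ) (p.1, i) (q.1, i) =
      if p.1 = q.1 then (d : ℂ)⁻¹ * o.trace else 0 := by
    calc ∑ i, (U * pairDepol a b o * Uᴴ) (p.1, i) (q.1, i)
        = ∑ i, ∑ c, ∑ y', ∑ y, ((d : ℂ)⁻¹ * ∑ j, o (y, j) (y', j)) *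
            (U (p.1, i) (y, c) * star (U (q.1, i) (y', c))) := by
          simp only [Matrix.mul_apply, Fintype.sum_prod_type_right, pairDepol_right hd ha hb,
            Matrix.conjTranspose_apply, mul_ite, mul_zero]
          refine Finset.sum_congr rfl fun i _ => Finset.sum_congr rfl fun c _ =>
            Finset.sum_congr rfl fun y' _ => ?_
          rw [Finset.sum_comm, Finset.sum_mul]
          refine Finset.sum_congr rfl fun y _ => ?_
          rw [Finset.sum_ite_eq' Finset.univ c]
          simp only [Finset.mem_univ, if_true]
          ring
      _ = ∑ y', ∑ y, ((d : ℂ)⁻¹ * ∑ j, o (y, j) (y', j)) *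
            ∑ i, ∑ c, (U (p.1, i) (y, c) * star (U (q.1, i) (y', c))) := by
          simp only [Finset.mul_sum (Finset.univ : Finset (Fin d)) _ ((d : ℂ)⁻¹ * _)]
          rw [sum_comm_four]
      _ = _ := by
          simp only [key, mul_ite, mul_one, mul_zero, ite_and, Matrix.trace, Matrix.diag,
            Fintype.sum_prod_type]
          split_ifs
          · rw [Finset.sum_comm (s := (Finset.univ : Finset (Fin d)))]
            simp [Finset.mul_sum]
          · simp
  rw [pairDepol_right hd ha hb, pairDepol_both ha' hb', conj_sum, Matrix.smul_apply,
    Matrix.smul_apply, Matrix.one_apply]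
  simp only [Prod.ext_iff, ite_and, smul_eq_mul]
  split_ifs <;> simp [sq, mul_assoc]

end Pair

section Step

variable {ι κ : Type*} [Fintype ι] [DecidableEq ι] [Fintype κ] [DecidableEq κ] {d : ℕ}

lemma depol_univ (O : Matrix (ι → Fin d) (ι → Fin d) ℂ) :
    depol Finset.univ O = (((d : ℂ) ^ Fintype.card ι)⁻¹ * O.trace) • 1 := by
  ext f g
  simp [depol, Matrix.one_apply, ← funext_iff, Matrix.trace]

/-- The pair `(x, y)` has both sites or none in the three nested complements `S₀ ⊆ S₁ ⊆ S₂`, or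
contributes exactly one site to the increments `S₁ \ S₀` and `S₂ \ S₁`. -/
def NestedPair (S₀ S₁ S₂ : Finset ι) (x y : ι) : Prop :=
  (x ∉ S₀ ∧ y ∉ S₀ ∧ x ∉ S₁ ∧ y ∉ S₁ ∧ x ∉ S₂ ∧ y ∉ S₂) ∨
  (x ∈ S₀ ∧ y ∈ S₀ ∧ x ∈ S₁ ∧ y ∈ S₁ ∧ x ∈ S₂ ∧ y ∈ S₂) ∨
  (x ∉ S₀ ∧ y ∉ S₀ ∧ x ∈ S₁ ∧ y ∉ S₁ ∧ x ∈ S₂ ∧ y ∈ S₂) ∨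
  (x ∉ S₀ ∧ y ∉ S₀ ∧ x ∉ S₁ ∧ y ∈ S₁ ∧ x ∈ S₂ ∧ y ∈ S₂)

variable {l r : κ → ι} {S₀ S₁ S₂ : Finset ι}
  {U : κ → Matrix (Fin d × Fin d) (Fin d × Fin d) ℂ}

/-- Conjugation `O ↦ V * O * Vᴴ` as a linear map. -/
noncomputable def conjMap {n : Type*} [Fintype n] (V : Matrix n n ℂ) :
    Matrix n n ℂ →ₗ[ℂ] Matrix n n ℂ where
  toFun O := V * O * Vᴴ
  map_add' O O' := by rw [Matrix.mul_add, Matrix.add_mul]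
  map_smul' c O := by simp

lemma conjMap_pairTensor (hb : Function.Bijective (Sum.elim l r))
    (o : κ → Matrix (Fin d × Fin d) (Fin d × Fin d) ℂ) :
    conjMap (pairTensor l r U) (pairTensor l r o) =
      pairTensor l r fun k => U k * o k * (U k)ᴴ := by
  simp [conjMap, conjTranspose_pairTensor, pairTensor_mul hb]

/-- Gates outside of the block preserve the depolarized state. -/
lemma depol_conj_depol_inner (hd : d ≠ 0) (hb : Function.Bijective (Sum.elim l r))
    (hU : ∀ k, U k ∈ Matrix.unitaryGroup (Fin d × Fin d) ℂ)
    (hS : ∀ k, NestedPair S₀ S₁ S₂ (l k) (r k)) (O : Matrix (ι → Fin d) (ι → Fin d) ℂ) :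
    depol S₁ (conjMap (pairTensor l r U) (depol S₀ O)) =
      depol S₁ (conjMap (pairTensor l r U) O) := by
  refine LinearMap.congr_fun (f := depol S₁ ∘ₗ conjMap (pairTensor l r U) ∘ₗ depol S₀)
    (g := depol S₁ ∘ₗ conjMap (pairTensor l r U)) (linearMap_ext_pairTensor hb fun o => ?_) O
  simp only [LinearMap.comp_apply, conjMap_pairTensor hb, depol_pairTensor hb]
  congr 1
  ext1 k
  rcases hS k with h | h | h | h
  · rw [pairDepol_neither hd h.1 h.2.1]
  · simp only [unitary_conj_pairDepol_both h.1 h.2.1 (hU k),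
      pairDepol_both h.2.2.1 h.2.2.2.1, trace_pairDepol hd, trace_unitary_conj (hU k)]
  · rw [pairDepol_neither hd h.1 h.2.1]
  · rw [pairDepol_neither hd h.1 h.2.1]

/-- By dual-unitarity, a cut gate acting on a half-depolarized pair depolarizes both sites. -/
lemma depol_conj_depol_middle (hd : d ≠ 0) (hb : Function.Bijective (Sum.elim l r))
    (hU : ∀ k, U k ∈ Matrix.unitaryGroup (Fin d × Fin d) ℂ)
    (hU' : ∀ k, reshuffle (U k) ∈ Matrix.unitaryGroup (Fin d × Fin d) ℂ)
    (hS : ∀ k, NestedPair S₀ S₁ S₂ (l k) (r k)) (O : Matrix (ι → Fin d) (ι → Fin d) ℂ) :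
    depol S₁ (conjMap (pairTensor l r U) (depol S₁ O)) =
      conjMap (pairTensor l r U) (depol S₂ O) := by
  refine LinearMap.congr_fun (f := depol S₁ ∘ₗ conjMap (pairTensor l r U) ∘ₗ depol S₁)
    (g := conjMap (pairTensor l r U) ∘ₗ depol S₂) (linearMap_ext_pairTensor hb fun o => ?_) O
  simp only [LinearMap.comp_apply, conjMap_pairTensor hb, depol_pairTensor hb]
  congr 1
  ext1 k
  rcases hS k with ⟨-, -, h₁, h₁', h₂, h₂'⟩ | ⟨-, -, h₁, h₁', h₂, h₂'⟩ |
    ⟨-, -, h₁, h₁', h₂, h₂'⟩ | ⟨-, -, h₁, h₁', h₂, h₂'⟩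
  · simp only [pairDepol_neither hd h₁ h₁', pairDepol_neither hd h₂ h₂']
  · rw [unitary_conj_pairDepol_both h₁ h₁' (hU k), unitary_conj_pairDepol_both h₂ h₂' (hU k),
      pairDepol_both h₁ h₁', trace_pairDepol hd, pairDepol_both h₂ h₂']
  · rw [unitary_conj_pairDepol_both h₂ h₂' (hU k), pairDepol_left_conj hd h₁ h₁' h₂ h₂' (hU' k)]
  · rw [unitary_conj_pairDepol_both h₂ h₂' (hU k), pairDepol_right_conj hd h₁ h₁' h₂ h₂' (hU' k)]

lemma depol_conj_depol_outer (hd : d ≠ 0) (hb : Function.Bijective (Sum.elim l r))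
    (hU : ∀ k, U k ∈ Matrix.unitaryGroup (Fin d × Fin d) ℂ)
    (hS : ∀ k, NestedPair S₀ S₁ S₂ (l k) (r k)) (O : Matrix (ι → Fin d) (ι → Fin d) ℂ) :
    depol S₂ (conjMap (pairTensor l r U) (depol S₂ O)) =
      conjMap (pairTensor l r U) (depol S₂ O) := by
  refine LinearMap.congr_fun (f := depol S₂ ∘ₗ conjMap (pairTensor l r U) ∘ₗ depol S₂)
    (g := conjMap (pairTensor l r U) ∘ₗ depol S₂) (linearMap_ext_pairTensor hb fun o => ?_) O
  simp only [LinearMap.comp_apply, conjMap_pairTensor hb, depol_pairTensor hb]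
  congr 1
  ext1 k
  have both (h : l k ∈ S₂) (h' : r k ∈ S₂) :
      pairDepol (l k ∈ S₂) (r k ∈ S₂) (U k * pairDepol (l k ∈ S₂) (r k ∈ S₂) (o k) * (U k)ᴴ) =
        U k * pairDepol (l k ∈ S₂) (r k ∈ S₂) (o k) * (U k)ᴴ := by
    rw [unitary_conj_pairDepol_both h h' (hU k), pairDepol_both h h', trace_pairDepol hd,
      ← pairDepol_both h h']
  rcases hS k with h | h | h | h
  · simp only [pairDepol_neither hd h.2.2.2.2.1 h.2.2.2.2.2]
  all_goals exact both h.2.2.2.2.1 h.2.2.2.2.2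

lemma depol_outer_depol_middle (hd : d ≠ 0) (hb : Function.Bijective (Sum.elim l r))
    (hS : ∀ k, NestedPair S₀ S₁ S₂ (l k) (r k)) (O : Matrix (ι → Fin d) (ι → Fin d) ℂ) :
    depol S₂ (depol S₁ O) = depol S₂ O := by
  refine LinearMap.congr_fun (f := depol S₂ ∘ₗ depol S₁)
    (g := depol S₂) (linearMap_ext_pairTensor hb fun o => ?_) O
  simp only [LinearMap.comp_apply, depol_pairTensor hb]
  congr 1
  ext1 k
  rcases hS k with h | h | h | h
  · simp only [pairDepol_neither hd h.2.2.1 h.2.2.2.1]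
  all_goals rw [pairDepol_both h.2.2.2.2.1 h.2.2.2.2.2, pairDepol_both h.2.2.2.2.1 h.2.2.2.2.2,
    trace_pairDepol hd]

lemma depol_conj_of_depol_eq (hd : d ≠ 0) (hb : Function.Bijective (Sum.elim l r))
    (hU : ∀ k, U k ∈ Matrix.unitaryGroup (Fin d × Fin d) ℂ)
    (hU' : ∀ k, reshuffle (U k) ∈ Matrix.unitaryGroup (Fin d × Fin d) ℂ)
    (hS : ∀ k, NestedPair S₀ S₁ S₂ (l k) (r k)) {O : Matrix (ι → Fin d) (ι → Fin d) ℂ}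
    (hO : depol S₀ O = depol S₁ O) :
    depol S₁ (conjMap (pairTensor l r U) O) = conjMap (pairTensor l r U) (depol S₂ O) := by
  rw [← depol_conj_depol_inner hd hb hU hS, hO, depol_conj_depol_middle hd hb hU hU' hS]

lemma depol_conj_eq_of_depol_eq (hd : d ≠ 0) (hb : Function.Bijective (Sum.elim l r))
    (hU : ∀ k, U k ∈ Matrix.unitaryGroup (Fin d × Fin d) ℂ)
    (hU' : ∀ k, reshuffle (U k) ∈ Matrix.unitaryGroup (Fin d × Fin d) ℂ)
    (hS : ∀ k, NestedPair S₀ S₁ S₂ (l k) (r k)) {O : Matrix (ι → Fin d) (ι → Fin d) ℂ}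
    (hO : depol S₀ O = depol S₁ O) :
    depol S₁ (conjMap (pairTensor l r U) O) = depol S₂ (conjMap (pairTensor l r U) O) := by
  rw [← depol_outer_depol_middle hd hb hS (conjMap _ O), depol_conj_of_depol_eq hd hb hU hU' hS hO,
    depol_conj_depol_outer hd hb hU hS]

/-- The projector onto the Bell pair `d^{-1/2} ∑ i, |i⟩ ⊗ |i⟩`. -/
noncomputable def bellProj (d : ℕ) : Matrix (Fin d × Fin d) (Fin d × Fin d) ℂ :=
  Matrix.of fun p q => if p.1 = p.2 ∧ q.1 = q.2 then (d : ℂ)⁻¹ else 0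

lemma bellProj_mul_self (hd : d ≠ 0) : bellProj d * bellProj d = bellProj d := by
  ext p q
  simp [bellProj, Matrix.mul_apply, Fintype.sum_prod_type, ite_and]
  split_ifs <;> simp [hd]

lemma trace_bellProj (hd : d ≠ 0) : (bellProj d).trace = 1 := by
  simp [bellProj, Matrix.trace, Fintype.sum_prod_type, hd]

lemma pairDepol_bellProj {a b : Prop} [Decidable a] [Decidable b] (hd : d ≠ 0) (hab : a ∨ b) :
    pairDepol a b (bellProj d) = ((d : ℂ) ^ 2)⁻¹ • 1 := by
  by_cases ha : a <;> by_cases hb : b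
  · rw [pairDepol_both ha hb, trace_bellProj hd, one_smul]
  · ext p q
    rw [pairDepol_left hd ha hb]
    simp [bellProj, Matrix.one_apply, Prod.ext_iff, ite_and, sq]
  · ext p q
    rw [pairDepol_right hd ha hb]
    simp only [bellProj, Matrix.of_apply, Matrix.smul_apply, Matrix.one_apply, Prod.ext_iff,
      ite_and, Finset.sum_ite_eq, Finset.mem_univ, if_true, eq_comm (a := q.1), smul_eq_mul]
    split_ifs <;> simp [sq]
  · tauto

lemma depol_bell_eq (hd : d ≠ 0) (hb : Function.Bijective (Sum.elim l r))
    (hS : ∀ k, (l k ∉ S₁ ∧ r k ∉ S₁ ∧ l k ∉ S₂ ∧ r k ∉ S₂) ∨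
      (l k ∈ S₁ ∨ r k ∈ S₁) ∧ l k ∈ S₂ ∧ r k ∈ S₂) :
    depol S₁ (pairTensor l r fun _ => bellProj d) =
      depol S₂ (pairTensor l r fun _ => bellProj d) := by
  simp only [depol_pairTensor hb]
  congr 1
  ext1 k
  rcases hS k with ⟨h₁, h₁', h₂, h₂'⟩ | ⟨h₁, h₂, -⟩
  · rw [pairDepol_neither hd h₁ h₁', pairDepol_neither hd h₂ h₂']
  · rw [pairDepol_bellProj hd h₁, pairDepol_bellProj hd (Or.inl h₂)]

lemma depol_bell_mul_self (hd : d ≠ 0) (hb : Function.Bijective (Sum.elim l r))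
    (hS : ∀ k, (l k ∉ S₂ ∧ r k ∉ S₂) ∨ (l k ∈ S₂ ∧ r k ∈ S₂)) :
    depol S₂ (pairTensor l r fun _ => bellProj d) * depol S₂ (pairTensor l r fun _ => bellProj d) =
      ((d : ℂ) ^ S₂.card)⁻¹ • depol S₂ (pairTensor l r fun _ => bellProj d) := by
  have hc : ((d : ℂ) ^ S₂.card)⁻¹ = ∏ k, (if l k ∈ S₂ then (d : ℂ)⁻¹ else 1) *
      (if r k ∈ S₂ then (d : ℂ)⁻¹ else 1) := by
    rw [← inv_pow, ← Finset.prod_const, ← Fintype.prod_ite_mem, ← hb.prod_comp,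
      Fintype.prod_sum_type, Finset.prod_mul_distrib]
    rfl
  rw [hc, depol_pairTensor hb, pairTensor_mul hb]
  ext f g
  simp only [pairTensor, Matrix.of_apply, Matrix.smul_apply, smul_eq_mul,
    ← Finset.prod_mul_distrib]
  refine Finset.prod_congr rfl fun k _ => ?_
  rcases hS k with ⟨h, h'⟩ | ⟨h, h'⟩
  · rw [pairDepol_neither hd h h', bellProj_mul_self hd]
    simp [h, h']
  · rw [pairDepol_bellProj hd (Or.inl h)]
    simp [h, h', sq]

end Step

section Rho

variable {N d : ℕ} (A : Finset (Fin N)) (Ψ : (Fin N → Fin d) → ℂ)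

/-- The global configuration that is `u` on `A` and `w` off `A`. -/
def glue {A : Finset (Fin N)} (u : {j // j ∈ A} → Fin d) (w : {j // j ∉ A} → Fin d) :
    Fin N → Fin d :=
  fun j => if hj : j ∈ A then u ⟨j, hj⟩ else w ⟨j, hj⟩

variable {A} in
lemma sum_glue (F : (Fin N → Fin d) → ℂ) :
    ∑ h, F h = ∑ u : {j // j ∈ A} → Fin d, ∑ w : {j // j ∉ A} → Fin d, F (glue u w) := by
  rw [← (Equiv.piEquivPiSubtypeProd (· ∈ A) fun _ => Fin d).symm.sum_comp, Fintype.sum_prod_type]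
  rfl

lemma depol_compl_glue (u v : {j // j ∈ A} → Fin d) (w w' : {j // j ∉ A} → Fin d) :
    depol Aᶜ (vecMulVec Ψ (star Ψ)) (glue u w) (glue v w') =
      if w = w' then ((d : ℂ) ^ N)⁻¹ * (d : ℂ) ^ A.card * rho A Ψ u v else 0 := by
  have hpw (u u' : {j // j ∈ A} → Fin d) (w w' : {j // j ∉ A} → Fin d) :
      Aᶜ.piecewise (glue u' w') (glue u w) = glue u w' := by
    ext j
    by_cases hj : j ∈ A <;> simp [glue, hj]
  simp only [depol, LinearMap.coe_mk, AddHom.coe_mk, Matrix.of_apply, sum_glue (A := A), hpw]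
  refine if_congr ⟨fun h => ?_, ?_⟩ ?_ rfl
  · ext ⟨j, hj⟩
    have := h j (by simpa using hj)
    simpa [glue, hj] using congrArg Fin.val this
  · rintro rfl j hj
    simp [glue, Finset.mem_compl.1 hj]
  · have hsum : ∑ x, Ψ (glue u x) * (starRingEnd ℂ) (Ψ (glue v x)) = rho A Ψ u v := rfl
    simp [vecMulVec_apply, mul_assoc, hsum]

lemma rho_mul_self (hd : d ≠ 0) {c : ℂ}
    (h : depol Aᶜ (vecMulVec Ψ (star Ψ)) * depol Aᶜ (vecMulVec Ψ (star Ψ)) =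
      c • depol Aᶜ (vecMulVec Ψ (star Ψ))) :
    rho A Ψ * rho A Ψ = (c * (d : ℂ) ^ N * ((d : ℂ) ^ A.card)⁻¹) • rho A Ψ := by
  have hd' : (d : ℂ) ≠ 0 := Nat.cast_ne_zero.2 hd
  have : NeZero d := ⟨hd⟩
  ext u v
  have huv := congrFun₂ h (glue u fun _ => 0) (glue v fun _ => 0)
  simp only [Matrix.mul_apply, sum_glue (A := A), depol_compl_glue, Matrix.smul_apply,
    smul_eq_mul, ite_mul, mul_ite, zero_mul, mul_zero, if_true] at huv
  simp only [Finset.sum_ite_eq', Finset.mem_univ, if_true] at huv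
  rw [Matrix.mul_apply, Matrix.smul_apply, smul_eq_mul]
  have hK : ((d : ℂ) ^ N)⁻¹ * (d : ℂ) ^ A.card ≠ 0 := by positivity
  have hK' : (d : ℂ) ^ N * ((d : ℂ) ^ A.card)⁻¹ * (((d : ℂ) ^ N)⁻¹ * (d : ℂ) ^ A.card) = 1 := by
    field_simp
  set K := ((d : ℂ) ^ N)⁻¹ * (d : ℂ) ^ A.card
  have huv' : K * K * ∑ x, rho A Ψ u x * rho A Ψ x v = c * (K * rho A Ψ u v) := by
    rw [← huv, Finset.mul_sum]
    exact Finset.sum_congr rfl fun x _ => by ring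
  refine mul_left_cancel₀ (mul_ne_zero hK hK) (huv'.trans ?_)
  linear_combination (-c * K * rho A Ψ u v) * hK'

lemma trace_rho : (rho A Ψ).trace = (vecMulVec Ψ (star Ψ)).trace := by
  simp only [Matrix.trace, Matrix.diag]
  rw [sum_glue (A := A)]
  rfl

end Rho

lemma trace_pow_of_mul_self {n : Type*} [Fintype n] [DecidableEq n] {R : Matrix n n ℂ} {c : ℂ}
    (h : R * R = c • R) (hR : R.trace = 1) (k : ℕ) : (R ^ (k + 1)).trace = c ^ k := by
  have : R ^ (k + 1) = c ^ k • R := by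
    induction k with
    | zero => simp
    | succ k ih => rw [pow_succ, ih, Matrix.smul_mul, h, smul_smul, pow_succ]
  rw [this, Matrix.trace_smul, hR, smul_eq_mul, mul_one]

lemma eq_of_modEq_of_dist_lt {n x y : ℕ} (h : x ≡ y [MOD n]) (hxy : x < y + n) (hyx : y < x + n) :
    x = y := by
  by_contra hne
  obtain hlt | hlt := Nat.lt_or_gt_of_ne hne
  · have := Nat.le_of_dvd (by omega) ((Nat.modEq_iff_dvd' hlt.le).1 h)
    omega
  · have := Nat.le_of_dvd (by omega) ((Nat.modEq_iff_dvd' hlt.le).1 h.symm)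
    omega

section Ring

variable {d L : ℕ} (hL : 0 < L)

/-- The site `x` of the ring of `2 * L` sites. -/
def ringSite (x : ℕ) : Fin (2 * L) := site (2 * L) (by omega) x

lemma ringSite_eq_iff {x y : ℕ} : ringSite hL x = ringSite hL y ↔ x ≡ y [MOD 2 * L] := by
  simp [ringSite, site, Nat.ModEq]

lemma pairs_bijective {c : ℕ} (hc : c < 2) : Function.Bijective
    (Sum.elim (fun k : Fin L => ringSite hL (2 * k.val + c))
      (fun k : Fin L => ringSite hL (2 * k.val + c + 1))) := by
  rw [Fintype.bijective_iff_surjective_and_card]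
  refine ⟨fun j => ?_, by simp; omega⟩
  have key (x : ℕ) (hx : x % (2 * L) = j) : ringSite hL x = j := Fin.ext hx
  have hj := j.isLt
  obtain hc | hc : c = 0 ∨ c = 1 := by omega
  · obtain h | h := Nat.mod_two_eq_zero_or_one j
    · exact ⟨.inl ⟨j / 2, by omega⟩, key _ (by simp only; rw [Nat.mod_eq_of_lt] <;> omega)⟩
    · exact ⟨.inr ⟨j / 2, by omega⟩, key _ (by simp only; rw [Nat.mod_eq_of_lt] <;> omega)⟩
  · obtain h | h := Nat.mod_two_eq_zero_or_one j
    · by_cases h0 : j.val = 0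
      · refine ⟨.inr ⟨L - 1, by omega⟩, key _ ?_⟩
        rw [h0, show 2 * (L - 1) + c + 1 = 2 * L by omega, Nat.mod_self]
      · exact ⟨.inr ⟨j / 2 - 1, by omega⟩, key _ (by simp only; rw [Nat.mod_eq_of_lt] <;> omega)⟩
    · exact ⟨.inl ⟨j / 2, by omega⟩, key _ (by simp only; rw [Nat.mod_eq_of_lt] <;> omega)⟩

/-- The block of `2 * M` sites centred at the bond `(z - 1, z)`. -/
def block (z M : ℕ) : Finset (Fin (2 * L)) := (Finset.Ico (z - M) (z + M)).image (ringSite hL)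

lemma ringSite_mem_block {z M i : ℕ} (hM : M < L) (hi : z ≤ i + L) (hi' : i ≤ z + L) :
    ringSite hL i ∈ block hL z M ↔ z - M ≤ i ∧ i < z + M := by
  simp only [block, Finset.mem_image, Finset.mem_Ico, ringSite_eq_iff]
  refine ⟨?_, fun h => ⟨i, h, rfl⟩⟩
  rintro ⟨j, hj, hji⟩
  have := eq_of_modEq_of_dist_lt hji (by omega) (by omega)
  omega

lemma card_block {z M : ℕ} (hz : L ≤ z) (hM : M < L) : (block hL z M).card = 2 * M := by
  rw [block, Finset.card_image_of_injOn]
  · simp; omega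
  · intro x hx y hy hxy
    simp only [Finset.coe_Ico, Set.mem_Ico] at hx hy
    rw [ringSite_eq_iff] at hxy
    exact eq_of_modEq_of_dist_lt hxy (by omega) (by omega)

/-- Every site has a representative in any window of `2 * L` consecutive integers. -/
lemma exists_window {z : ℕ} (hz : L ≤ z) (x : ℕ) :
    ∃ q, z ≤ q + L ∧ q < z + L ∧ q % 2 = x % 2 ∧ ringSite hL x = ringSite hL q ∧
      ringSite hL (x + 1) = ringSite hL (q + 1) := by
  obtain ⟨b, rfl⟩ := Nat.exists_eq_add_of_le hz
  have hq : b + (x + (2 * L - 1) * b) % (2 * L) ≡ x [MOD 2 * L] := by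
    have h1 : b + (x + (2 * L - 1) * b) % (2 * L) ≡ b + (x + (2 * L - 1) * b) [MOD 2 * L] :=
      (Nat.mod_modEq _ _).add_left b
    refine h1.trans ?_
    have h2 : b + (x + (2 * L - 1) * b) = x + 2 * L * b := by
      obtain ⟨n, hn⟩ : ∃ n, 2 * L = n + 1 := ⟨2 * L - 1, by omega⟩
      rw [hn, Nat.add_sub_cancel]
      ring
    rw [h2]
    simp [Nat.ModEq]
  have hlt := Nat.mod_lt (x + (2 * L - 1) * b) (show 0 < 2 * L by omega)
  exact ⟨_, by omega, by omega, hq.of_dvd (Dvd.intro _ rfl),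
    (ringSite_eq_iff hL).2 hq.symm, (ringSite_eq_iff hL).2 (hq.symm.add_right 1)⟩

lemma nestedPair_block {z M c : ℕ} (hz : L ≤ z) (hM : M + 3 ≤ L) (hc : (z + M) % 2 = c % 2)
    (k : ℕ) : NestedPair (block hL z (M + 2))ᶜ (block hL z (M + 1))ᶜ (block hL z M)ᶜ
      (ringSite hL (2 * k + c)) (ringSite hL (2 * k + c + 1)) := by
  obtain ⟨q, hq, hq', hq2, hqx, hqx'⟩ := exists_window hL hz (2 * k + c)
  rw [hqx, hqx']
  simp only [NestedPair, Finset.mem_compl, not_not]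
  have e (M' : ℕ) (h : M' < L) := ringSite_mem_block hL (z := z) (i := q) h (by omega) (by omega)
  have e' (M' : ℕ) (h : M' < L) := ringSite_mem_block hL (z := z) (i := q + 1) h (by omega) (by omega)
  rw [e _ (by omega), e _ (by omega), e _ (by omega), e' _ (by omega), e' _ (by omega),
    e' _ (by omega)]
  obtain h | h | h | h : (z - M ≤ q ∧ q + 1 < z + M) ∨ (q + 1 < z - (M + 2) ∨ z + (M + 2) ≤ q) ∨
      q + 1 = z - (M + 1) ∨ q = z + M := by omega
  · exact Or.inl (by omega)
  · exact Or.inr (Or.inl (by omega))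
  · exact Or.inr (Or.inr (Or.inl (by omega)))
  · exact Or.inr (Or.inr (Or.inr (by omega)))

lemma bellPair_block {z M c : ℕ} (hz : L ≤ z) (hM : M + 2 ≤ L) (hc : (z + M) % 2 = c % 2)
    (k : ℕ) : (ringSite hL (2 * k + c) ∉ (block hL z (M + 1))ᶜ ∧
        ringSite hL (2 * k + c + 1) ∉ (block hL z (M + 1))ᶜ ∧
        ringSite hL (2 * k + c) ∉ (block hL z M)ᶜ ∧
        ringSite hL (2 * k + c + 1) ∉ (block hL z M)ᶜ) ∨
      (ringSite hL (2 * k + c) ∈ (block hL z (M + 1))ᶜ ∨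
        ringSite hL (2 * k + c + 1) ∈ (block hL z (M + 1))ᶜ) ∧
        ringSite hL (2 * k + c) ∈ (block hL z M)ᶜ ∧
        ringSite hL (2 * k + c + 1) ∈ (block hL z M)ᶜ := by
  obtain ⟨q, hq, hq', hq2, hqx, hqx'⟩ := exists_window hL hz (2 * k + c)
  rw [hqx, hqx']
  simp only [Finset.mem_compl, not_not]
  have e (M' : ℕ) (h : M' < L) := ringSite_mem_block hL (z := z) (i := q) h (by omega) (by omega)
  have e' (M' : ℕ) (h : M' < L) := ringSite_mem_block hL (z := z) (i := q + 1) h (by omega) (by omega)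
  rw [e _ (by omega), e _ (by omega), e' _ (by omega), e' _ (by omega)]
  omega

end Ring

section Circuit

variable {d L : ℕ} (hL : 0 < L) (Uo Ue : Fin L → Matrix (Fin d × Fin d) (Fin d × Fin d) ℂ)

/-- The layer of two-site gates on the pairs `(2 * k + c, 2 * k + c + 1)`. -/
noncomputable def layer (c : ℕ) (U : Fin L → Matrix (Fin d × Fin d) (Fin d × Fin d) ℂ) :
    Matrix (Cfg d (2 * L)) (Cfg d (2 * L)) ℂ :=
  pairTensor (fun k : Fin L => ringSite hL (2 * k.val + c))
    (fun k : Fin L => ringSite hL (2 * k.val + c + 1)) U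

/-- The gates of the layer applied at the half step `s`. -/
def gates (s : ℕ) : Fin L → Matrix (Fin d × Fin d) (Fin d × Fin d) ℂ :=
  if s % 2 = 0 then Uo else Ue

/-- The density matrix of the full ring after `s` half steps. -/
noncomputable def evolved : ℕ → Matrix (Cfg d (2 * L)) (Cfg d (2 * L)) ℂ
  | 0 => layer hL 1 fun _ => bellProj d
  | s + 1 => conjMap (layer hL (s % 2) (gates Uo Ue s)) (evolved s)

lemma vecMulVec_bellState :
    vecMulVec (bellState d L hL) (star (bellState d L hL)) = layer hL 1 fun _ => bellProj d := by
  have hs : ((Real.sqrt d : ℂ))⁻¹ * ((Real.sqrt d : ℂ))⁻¹ = (d : ℂ)⁻¹ := by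
    rw [← mul_inv, ← Complex.ofReal_mul, Real.mul_self_sqrt (Nat.cast_nonneg d),
      Complex.ofReal_natCast]
  ext f g
  have hl (k : Fin L) : site (2 * L) (by omega) (2 * k.val + 1) = ringSite hL (2 * k.val + 1) := rfl
  have hr (k : Fin L) : site (2 * L) (by omega) (2 * k.val + 2) =
    ringSite hL (2 * k.val + 1 + 1) := rfl
  simp only [vecMulVec_apply, Pi.star_apply, bellState, layer, pairTensor, bellProj,
    Matrix.of_apply, Finset.prod_ite_zero, Finset.mem_univ, true_imp_iff,
    Finset.prod_const, Finset.card_univ, Fintype.card_fin, hl, hr, ite_and]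
  rw [← hs]
  split_ifs <;> simp [mul_pow]

lemma conjMap_vecMulVec {n : Type*} [Fintype n] (V : Matrix n n ℂ) (ψ : n → ℂ) :
    conjMap V (vecMulVec ψ (star ψ)) = vecMulVec (V *ᵥ ψ) (star (V *ᵥ ψ)) := by
  change V * vecMulVec ψ (star ψ) * Vᴴ = _
  rw [Matrix.mul_vecMulVec, Matrix.vecMulVec_mul, Matrix.star_mulVec]

lemma evolved_two_mul (t : ℕ) :
    evolved hL Uo Ue (2 * t) =
      vecMulVec (((evenLayer d L hL Ue * oddLayer d L hL Uo) ^ t).mulVec (bellState d L hL))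
        (star (((evenLayer d L hL Ue * oddLayer d L hL Uo) ^ t).mulVec (bellState d L hL))) := by
  induction t with
  | zero => simp [evolved, vecMulVec_bellState]
  | succ t ih =>
    have h0 : gates Uo Ue (2 * t) = Uo := by simp [gates]
    have h1 : gates Uo Ue (2 * t + 1) = Ue := by simp [gates]
    have m0 : 2 * t % 2 = 0 := by omega
    have m1 : (2 * t + 1) % 2 = 1 := by omega
    have ho : layer hL 0 Uo = oddLayer d L hL Uo := rfl
    have he : layer hL 1 Ue = evenLayer d L hL Ue := rfl
    rw [pow_succ', ← Matrix.mulVec_mulVec, ← Matrix.mulVec_mulVec, ← conjMap_vecMulVec,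
      ← conjMap_vecMulVec, ← ih, show 2 * (t + 1) = 2 * t + 1 + 1 by ring, evolved, evolved,
      h0, h1, m0, m1, ho, he]

variable {Uo Ue}

lemma conjMap_mul {n : Type*} [Fintype n] [DecidableEq n] {V : Matrix n n ℂ}
    (hV : V ∈ Matrix.unitaryGroup n ℂ) (O O' : Matrix n n ℂ) :
    conjMap V O * conjMap V O' = conjMap V (O * O') := by
  have : Vᴴ * V = 1 := Matrix.mem_unitaryGroup_iff'.1 hV
  change V * O * Vᴴ * (V * O' * Vᴴ) = V * (O * O') * Vᴴ
  calc _ = V * O * (Vᴴ * V) * O' * Vᴴ := by simp only [Matrix.mul_assoc]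
    _ = _ := by rw [this, Matrix.mul_one]; simp only [Matrix.mul_assoc]

section

variable (hd : d ≠ 0)
  (hUo : ∀ k, Uo k ∈ Matrix.unitaryGroup (Fin d × Fin d) ℂ)
  (hUe : ∀ k, Ue k ∈ Matrix.unitaryGroup (Fin d × Fin d) ℂ)
  (hUo' : ∀ k, reshuffle (Uo k) ∈ Matrix.unitaryGroup (Fin d × Fin d) ℂ)
  (hUe' : ∀ k, reshuffle (Ue k) ∈ Matrix.unitaryGroup (Fin d × Fin d) ℂ)

include hUo hUe in
lemma gates_unitary (s : ℕ) (k : Fin L) :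
    gates Uo Ue s k ∈ Matrix.unitaryGroup (Fin d × Fin d) ℂ := by
  unfold gates
  split_ifs
  exacts [hUo k, hUe k]

include hUo' hUe' in
lemma reshuffle_gates_unitary (s : ℕ) (k : Fin L) :
    reshuffle (gates Uo Ue s k) ∈ Matrix.unitaryGroup (Fin d × Fin d) ℂ := by
  unfold gates
  split_ifs
  exacts [hUo' k, hUe' k]

include hUo hUe in
lemma layer_gates_unitary (s : ℕ) :
    layer hL (s % 2) (gates Uo Ue s) ∈ Matrix.unitaryGroup (Cfg d (2 * L)) ℂ :=
  pairTensor_mem_unitaryGroup (pairs_bijective hL (Nat.mod_lt s two_pos))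
    (gates_unitary hUo hUe s)

include hd hUo hUe in
lemma trace_evolved (s : ℕ) : (evolved hL Uo Ue s).trace = 1 := by
  induction s with
  | zero =>
    rw [evolved, layer, trace_pairTensor (pairs_bijective hL one_lt_two)]
    simp [trace_bellProj hd]
  | succ s ih =>
    rw [evolved, ← ih]
    exact trace_unitary_conj (layer_gates_unitary hL hUo hUe s) _

include hUo' hUe' hd hUo hUe in
/-- The end sites of a block cut by the last layer are maximally mixed and uncorrelated with the
interior of the block. -/
lemma depol_evolved {z : ℕ} (hz : L ≤ z) (s M : ℕ) (hpar : (z + M + s) % 2 = 1)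
    (hM : M + 2 + s ≤ L) :
    depol (block hL z (M + 1))ᶜ (evolved hL Uo Ue s) =
      depol (block hL z M)ᶜ (evolved hL Uo Ue s) := by
  induction s generalizing M with
  | zero =>
    exact depol_bell_eq hd (pairs_bijective hL one_lt_two) fun k =>
      bellPair_block hL hz (by omega) (by omega) k
  | succ s ih =>
    exact depol_conj_eq_of_depol_eq hd (pairs_bijective hL (Nat.mod_lt s two_pos))
      (gates_unitary hUo hUe s) (reshuffle_gates_unitary hUo' hUe' s)
      (fun k => nestedPair_block hL hz (by omega) (by omega) k) (ih (M + 1) (by omega) (by omega))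

include hd hUo hUe hUo' hUe' in
lemma depol_evolved_mul_self {z : ℕ} (hz : L ≤ z) (s M : ℕ) (hpar : (z + M + s) % 2 = 0)
    (hM : M + s + 1 ≤ L) :
    depol (block hL z M)ᶜ (evolved hL Uo Ue s) * depol (block hL z M)ᶜ (evolved hL Uo Ue s) =
      ((d : ℂ) ^ (2 * L - 2 * M + 2 * min (s + 1) M))⁻¹ •
        depol (block hL z M)ᶜ (evolved hL Uo Ue s) := by
  have hzero (s : ℕ) : depol (block hL z 0)ᶜ (evolved hL Uo Ue s) =
      ((d : ℂ) ^ (2 * L))⁻¹ • 1 := by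
    have hblock : (block hL z 0)ᶜ = Finset.univ := by simp [block]
    rw [hblock, depol_univ, trace_evolved hL hd hUo hUe, mul_one, Fintype.card_fin]
  induction s generalizing M with
  | zero =>
    cases M with
    | zero => simp [hzero]
    | succ M =>
      rw [depol_evolved hL hd hUo hUe hUo' hUe' hz 0 M (by omega) (by omega)]
      have hcard : (block hL z M)ᶜ.card = 2 * L - 2 * (M + 1) + 2 * min (0 + 1) (M + 1) := by
        rw [Finset.card_compl, card_block hL hz (by omega), Fintype.card_fin]
        omega
      rw [← hcard]
      refine depol_bell_mul_self hd (pairs_bijective hL one_lt_two) fun k => ?_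
      have := bellPair_block hL hz (M := M) (c := 1) (by omega) (by omega) k
      tauto
  | succ s ih =>
    cases M with
    | zero => simp [hzero]
    | succ M =>
      have hstep : depol (block hL z (M + 1))ᶜ (evolved hL Uo Ue (s + 1)) =
          conjMap (layer hL (s % 2) (gates Uo Ue s))
            (depol (block hL z M)ᶜ (evolved hL Uo Ue s)) :=
        depol_conj_of_depol_eq hd (pairs_bijective hL (Nat.mod_lt s two_pos))
          (gates_unitary hUo hUe s) (reshuffle_gates_unitary hUo' hUe' s)
          (fun k => nestedPair_block hL hz (by omega) (by omega) k)
          (depol_evolved hL hd hUo hUe hUo' hUe' hz s (M + 1) (by omega) (by omega))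
      have hexp : 2 * L - 2 * (M + 1) + 2 * min (s + 1 + 1) (M + 1) =
          2 * L - 2 * M + 2 * min (s + 1) M := by omega
      rw [hstep, conjMap_mul (layer_gates_unitary hL hUo hUe s), ih M (by omega) (by omega),
        map_smul, hexp]

end

end Circuit

theorem maximal_entanglement_growth_in_dual_unitary_circuits
    (d : ℕ) (hd : 2 ≤ d)
    (L t m a : ℕ) (hmL : m + 2 * t + 1 ≤ L)
    (Uo Ue : Fin L → Matrix (Fin d × Fin d) (Fin d × Fin d) ℂ)
    (hUo : ∀ k, Uo k ∈ Matrix.unitaryGroup (Fin d × Fin d) ℂ)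
    (hUe : ∀ k, Ue k ∈ Matrix.unitaryGroup (Fin d × Fin d) ℂ)
    (hUo' : ∀ k, reshuffle (Uo k) ∈ Matrix.unitaryGroup (Fin d × Fin d) ℂ)
    (hUe' : ∀ k, reshuffle (Ue k) ∈ Matrix.unitaryGroup (Fin d × Fin d) ℂ)
    (n : ℕ) (hn : 2 ≤ n) :
    Matrix.trace
        ((rho ((Finset.univ : Finset (Fin (2 * m))).image
            (fun i => site (2 * L) (by omega) (2 * a + i.val)))
          (((evenLayer d L (by omega) Ue * oddLayer d L (by omega) Uo) ^ t).mulVec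
            (bellState d L (by omega)))) ^ n) =
      (((d : ℂ) ^ (2 * (n - 1) * min (2 * t + 1) m)))⁻¹ := by
  have hL : 0 < L := by omega
  have hd' : d ≠ 0 := by omega
  have hz : L ≤ 2 * a + m + 2 * L := by omega
  have hA : (Finset.univ : Finset (Fin (2 * m))).image
      (fun i => site (2 * L) (by omega) (2 * a + i.val)) = block hL (2 * a + m + 2 * L) m := by
    ext j
    simp only [block, Finset.mem_image, Finset.mem_univ, true_and, Finset.mem_Ico]
    constructor
    · rintro ⟨i, rfl⟩
      exact ⟨2 * a + i + 2 * L, by omega, by simp [ringSite, site]⟩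
    · rintro ⟨x, hx, rfl⟩
      obtain ⟨y, rfl⟩ := Nat.exists_eq_add_of_le (show 2 * a + 2 * L ≤ x by omega)
      refine ⟨⟨y, by omega⟩, ?_⟩
      change ringSite hL (2 * a + y) = _
      rw [ringSite_eq_iff, add_right_comm]
      simp [Nat.ModEq]
  have hsq := depol_evolved_mul_self hL hd' hUo hUe hUo' hUe' hz (2 * t) m (by omega) (by omega)
  have htr := trace_evolved hL hd' hUo hUe (2 * t)
  rw [evolved_two_mul] at hsq htr
  rw [hA]
  obtain ⟨k, rfl⟩ : ∃ k, n = k + 1 := ⟨n - 1, by omega⟩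
  rw [trace_pow_of_mul_self (rho_mul_self _ _ hd' hsq) ((trace_rho _ _).trans htr),
    card_block hL hz (by omega), Nat.add_sub_cancel]
  have hd0 : (d : ℂ) ≠ 0 := Nat.cast_ne_zero.2 hd'
  have hexp : (d : ℂ) ^ (2 * L) = (d : ℂ) ^ (2 * L - 2 * m) * (d : ℂ) ^ (2 * m) := by
    rw [← pow_add]
    congr 1
    omega
  have hbase : ((d : ℂ) ^ (2 * L - 2 * m + 2 * min (2 * t + 1) m))⁻¹ * (d : ℂ) ^ (2 * L) *
      ((d : ℂ) ^ (2 * m))⁻¹ = ((d : ℂ) ^ (2 * min (2 * t + 1) m))⁻¹ := by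
    rw [hexp, pow_add]
    field_simp
  rw [hbase, inv_pow, ← pow_mul]
  congr 2
  ring
end

section
/- Relaxation of the local magnetization in the thermodynamic limit of the Floquet XX circuit: fix ω ∈ (0, π) and define, for k ∈ [0, π], Φ(k) = arctan(tan(ω/2) sin k) + π·𝟙[k > π/2], f(k) = cos²(Φ(k)), g(k) = sin²(Φ(k)), and ε(k) = arctan( sqrt( sin⁴(ω/2) sin²(2k) + sin²(ω) cos²(k) ) / ( cos²(ω/2) − sin²(ω/2) cos(2k) ) ). Then lim_{t→∞} ∫₀^π f(k) cos(2 t ε(k)) dk = 0 (the limit taken over t ∈ ℕ); consequently the thermodynamic-limit magnetization (−1)^x (1/(4π)) ∫₀^π [ g(k) + f(k) cos(2 t ε(k)) ] dk attains the well-defined infinite-time limit (−1)^x (1/(4π)) ∫₀^π g(k) dk. -/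
/- Relaxation of the local magnetization in the thermodynamic limit of the
Floquet XX circuit. -/

open Real Filter

/-- The dressing angle `Φ(k) = arctan(tan(ω/2) sin k) + π·𝟙[k > π/2]`. -/
noncomputable def Phi (ω k : ℝ) : ℝ :=
  Real.arctan (Real.tan (ω / 2) * Real.sin k) + π * (if π / 2 < k then 1 else 0)

/-- The mode occupation factor `f(k) = cos²(Φ(k))`. -/
noncomputable def fOcc (ω k : ℝ) : ℝ := Real.cos (Phi ω k) ^ 2

/-- The mode occupation factor `g(k) = sin²(Φ(k))`. -/
noncomputable def gOcc (ω k : ℝ) : ℝ := Real.sin (Phi ω k) ^ 2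

/-- The quasi-energy dispersion `ε(k)`. -/
noncomputable def epsDisp (ω k : ℝ) : ℝ :=
  Real.arctan
    (Real.sqrt (Real.sin (ω / 2) ^ 4 * Real.sin (2 * k) ^ 2 +
        Real.sin ω ^ 2 * Real.cos k ^ 2) /
      (Real.cos (ω / 2) ^ 2 - Real.sin (ω / 2) ^ 2 * Real.cos (2 * k)))

/-- Riemann–Lebesgue lemma with a phase `θ` that is injective with nonvanishing derivative. -/
theorem tendsto_setIntegral_mul_cos_phase {s : Set ℝ} (hs : MeasurableSet s) {θ θ' f : ℝ → ℝ}
    (hθ : ∀ x ∈ s, HasDerivAt θ (θ' x) x) (hinj : Set.InjOn θ s) (hne : ∀ x ∈ s, θ' x ≠ 0)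
    (hf : MeasureTheory.IntegrableOn f s) :
    Tendsto (fun w : ℝ => ∫ x in s, f x * Real.cos (2 * π * (θ x * w)))
      (cocompact ℝ) (nhds 0) := by
  set φ := Function.invFunOn θ s
  have hφ : ∀ x ∈ s, φ (θ x) = x := fun x hx => hinj.leftInvOn_invFunOn hx
  have hθm : AEMeasurable θ (MeasureTheory.volume.restrict s) :=
    ContinuousOn.aemeasurable (fun x hx => (hθ x hx).continuousAt.continuousWithinAt) hs
  have himg : MeasurableSet (θ '' s) :=
    MeasureTheory.measurable_image_of_fderivWithin hs
      (fun x hx => (hθ x hx).hasDerivWithinAt.hasFDerivWithinAt) hinj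
  have key := Real.tendsto_integral_exp_smul_cocompact
    ((θ '' s).indicator fun y => ((f (φ y) / |θ' (φ y)| : ℝ) : ℂ))
  have hre := (Complex.continuous_re.tendsto 0).comp key
  refine hre.congr fun w => ?_
  have h1 : ∫ v : ℝ, Real.fourierChar (-(v * w)) •
        (θ '' s).indicator (fun y => ((f (φ y) / |θ' (φ y)| : ℝ) : ℂ)) v =
      ∫ x in s, Real.fourierChar (-(θ x * w)) • (f x : ℂ) := by
    have h0 (v : ℝ) : Real.fourierChar (-(v * w)) •
        (θ '' s).indicator (fun y => ((f (φ y) / |θ' (φ y)| : ℝ) : ℂ)) v =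
        (θ '' s).indicator (fun y => Real.fourierChar (-(y * w)) •
          ((f (φ y) / |θ' (φ y)| : ℝ) : ℂ)) v := by
      by_cases hv : v ∈ θ '' s <;> simp [hv]
    simp_rw [h0]
    rw [MeasureTheory.integral_indicator himg,
      MeasureTheory.integral_image_eq_integral_abs_deriv_smul hs
        (fun x hx => (hθ x hx).hasDerivWithinAt) hinj]
    refine MeasureTheory.setIntegral_congr_fun hs fun x hx => ?_
    have h2 : ((|θ' x| : ℝ) : ℂ) ≠ 0 := by simpa using hne x hx
    simp only [hφ x hx, Circle.smul_def, Complex.real_smul, smul_eq_mul, Complex.ofReal_div]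
    field_simp
  have hint : MeasureTheory.Integrable (fun x => Real.fourierChar (-(θ x * w)) • (f x : ℂ))
      (MeasureTheory.volume.restrict s) := by
    refine MeasureTheory.Integrable.mono hf (AEMeasurable.aestronglyMeasurable ?_) (by simp [Circle.smul_def, Circle.norm_coe])
    have hfm := hf.aestronglyMeasurable.aemeasurable
    simp only [Circle.smul_def, Real.fourierChar_apply, smul_eq_mul]
    fun_prop
  simp only [Function.comp_apply]
  rw [h1]
  refine (integral_re hint).symm.trans ?_
  refine MeasureTheory.setIntegral_congr_fun hs fun x hx => ?_
  simp only [Circle.smul_def, Real.fourierChar_apply, smul_eq_mul]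
  rw [mul_comm (f x), RCLike.re_eq_complex_re, Complex.re_mul_ofReal, show (((2 * π * -(θ x * w) : ℝ) : ℂ)) * Complex.I
    = ((-(2 * π * (θ x * w)) : ℝ) : ℂ) * Complex.I by push_cast; ring,
    Complex.exp_ofReal_mul_I_re, Real.cos_neg]

theorem cos_two_mul_arctan_sqrt_div {a c S : ℝ} (hc : c ≠ 0) (hS : 0 ≤ S) (h : S + c ^ 2 = 1)
    (hca : c = Real.cos a) : Real.cos (2 * Real.arctan (Real.sqrt S / c)) = Real.cos (2 * a) := by
  rw [Real.cos_two_mul, Real.cos_two_mul, Real.cos_sq_arctan, div_pow, Real.sq_sqrt hS, ← hca]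
  have : 1 + S / c ^ 2 = 1 / c ^ 2 := by
    field_simp
    linarith
  rw [this]
  simp

theorem cos_two_nat_mul_epsDisp (ω k : ℝ) (t : ℕ)
    (hk : 1 - 2 * (Real.sin (ω / 2) * Real.cos k) ^ 2 ≠ 0) :
    Real.cos (2 * t * epsDisp ω k) =
      Real.cos (4 * t * Real.arcsin (Real.sin (ω / 2) * Real.cos k)) := by
  set y := Real.sin (ω / 2) * Real.cos k with hy
  have habs : |y| ≤ 1 := by
    rw [hy, abs_mul]
    exact mul_le_one₀ (Real.abs_sin_le_one _) (abs_nonneg _) (Real.abs_cos_le_one _)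
  have hcos : 1 - 2 * y ^ 2 = Real.cos (2 * Real.arcsin y) := by
    rw [Real.cos_two_mul', Real.cos_sq', Real.sin_arcsin (abs_le.mp habs).1 (abs_le.mp habs).2]
    ring
  have hden : Real.cos (ω / 2) ^ 2 - Real.sin (ω / 2) ^ 2 * Real.cos (2 * k) = 1 - 2 * y ^ 2 := by
    rw [Real.cos_two_mul, Real.cos_sq' (ω / 2), hy]
    ring
  have hsum : Real.sin (ω / 2) ^ 4 * Real.sin (2 * k) ^ 2 + Real.sin ω ^ 2 * Real.cos k ^ 2
      + (1 - 2 * y ^ 2) ^ 2 = 1 := by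
    rw [show Real.sin ω = 2 * Real.sin (ω / 2) * Real.cos (ω / 2) by
      rw [← Real.sin_two_mul]; ring_nf, Real.sin_two_mul, hy]
    simp only [mul_pow, Real.cos_sq' (ω / 2), Real.sin_sq k]
    ring
  have h2 : Real.cos (2 * epsDisp ω k) = Real.cos (2 * (2 * Real.arcsin y)) := by
    rw [epsDisp, hden]
    exact cos_two_mul_arctan_sqrt_div hk (by positivity) hsum hcos
  have h3 := congrArg (fun z => (Polynomial.Chebyshev.T ℝ t).eval z) h2
  simp only [Polynomial.Chebyshev.T_real_cos] at h3
  push_cast at h3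
  convert h3 using 2 <;> ring

theorem ae_one_sub_two_mul_sq_ne_zero {a : ℝ} (ha : a ≠ 0) :
    ∀ᵐ k : ℝ, k ∈ Set.Ioo 0 π → 1 - 2 * (a * Real.cos k) ^ 2 ≠ 0 := by
  set b := 1 / (Real.sqrt 2 * a) with hb
  have hfin : ({Real.arccos b, Real.arccos (-b)} : Set ℝ).Finite := by simp
  filter_upwards [MeasureTheory.compl_mem_ae_iff.mpr (hfin.measure_zero _)] with k hk hk0 h
  have hb2 : Real.cos k ^ 2 = b ^ 2 := by
    rw [hb, div_pow, mul_pow, Real.sq_sqrt (by norm_num)]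
    field_simp
    linarith
  refine hk ?_
  rw [← Real.arccos_cos hk0.1.le hk0.2.le]
  rcases sq_eq_sq_iff_eq_or_eq_neg.mp hb2 with h | h <;> simp [h]

theorem measurable_Phi (ω : ℝ) : Measurable (Phi ω) := by
  unfold Phi
  have : Measurable fun k : ℝ => if π / 2 < k then (1 : ℝ) else 0 :=
    Measurable.ite measurableSet_Ioi measurable_const measurable_const
  fun_prop

theorem measurable_fOcc (ω : ℝ) : Measurable (fOcc ω) :=
  (Real.measurable_cos.comp (measurable_Phi ω)).pow_const 2

theorem measurable_gOcc (ω : ℝ) : Measurable (gOcc ω) :=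
  (Real.measurable_sin.comp (measurable_Phi ω)).pow_const 2

theorem measurable_epsDisp (ω : ℝ) : Measurable (epsDisp ω) := by
  unfold epsDisp
  fun_prop

theorem abs_fOcc_le_one (ω k : ℝ) : |fOcc ω k| ≤ 1 := by
  rw [fOcc, abs_of_nonneg (sq_nonneg _)]
  exact Real.cos_sq_le_one _

theorem abs_gOcc_le_one (ω k : ℝ) : |gOcc ω k| ≤ 1 := by
  rw [gOcc, abs_of_nonneg (sq_nonneg _)]
  exact Real.sin_sq_le_one _

theorem intervalIntegrable_of_measurable_of_abs_le {h : ℝ → ℝ} (hm : Measurable h) {C : ℝ}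
    (hC : ∀ x, |h x| ≤ C) (a b : ℝ) :
    IntervalIntegrable h MeasureTheory.volume a b :=
  (intervalIntegrable_const (c := C)).mono_fun' hm.aestronglyMeasurable
    (Eventually.of_forall hC)

theorem tendsto_integral_fOcc_mul_cos {ω : ℝ} (hω : ω ∈ Set.Ioo 0 π) :
    Tendsto (fun t : ℕ => ∫ k in (0 : ℝ)..π, fOcc ω k * Real.cos (2 * t * epsDisp ω k))
      atTop (nhds 0) := by
  set a := Real.sin (ω / 2) with ha
  have ha0 : 0 < a := Real.sin_pos_of_pos_of_lt_pi (by linarith [hω.1]) (by linarith [hω.1, hω.2])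
  have ha1 : a < 1 := by
    rw [ha, ← Real.sin_pi_div_two]
    exact Real.sin_lt_sin_of_lt_of_le_pi_div_two (by linarith [hω.1, Real.pi_pos]) le_rfl
      (by linarith [hω.2])
  have hlt (k : ℝ) : -1 < a * Real.cos k ∧ a * Real.cos k < 1 := by
    constructor <;> nlinarith [Real.neg_one_le_cos k, Real.cos_le_one k]
  have hderiv (k : ℝ) : HasDerivAt (fun k => Real.arcsin (a * Real.cos k))
      (1 / Real.sqrt (1 - (a * Real.cos k) ^ 2) * (a * -Real.sin k)) k :=
    (Real.hasDerivAt_arcsin (hlt k).1.ne' (hlt k).2.ne).comp (h := fun k => a * Real.cos k) k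
      ((Real.hasDerivAt_cos k).const_mul a)
  have hinj : Set.InjOn (fun k => Real.arcsin (a * Real.cos k)) (Set.Ioo 0 π) := by
    intro x hx y hy hxy
    have h := Real.injOn_arcsin ⟨(hlt x).1.le, (hlt x).2.le⟩ ⟨(hlt y).1.le, (hlt y).2.le⟩ hxy
    exact Real.injOn_cos (Set.Ioo_subset_Icc_self hx) (Set.Ioo_subset_Icc_self hy)
      (mul_left_cancel₀ ha0.ne' h)
  have hne : ∀ k ∈ Set.Ioo 0 π,
      1 / Real.sqrt (1 - (a * Real.cos k) ^ 2) * (a * -Real.sin k) ≠ 0 := by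
    intro k hk
    have h1 : 0 < Real.sqrt (1 - (a * Real.cos k) ^ 2) :=
      Real.sqrt_pos.mpr (by nlinarith [hlt k])
    have h2 := Real.sin_pos_of_pos_of_lt_pi hk.1 hk.2
    exact mul_ne_zero (by positivity) (mul_ne_zero ha0.ne' (neg_ne_zero.mpr h2.ne'))
  have hfi : MeasureTheory.IntegrableOn (fOcc ω) (Set.Ioo 0 π) :=
    ((intervalIntegrable_iff_integrableOn_Ioo_of_le Real.pi_pos.le).mp
      (intervalIntegrable_of_measurable_of_abs_le (measurable_fOcc ω) (abs_fOcc_le_one ω) 0 π))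
  have hRL := tendsto_setIntegral_mul_cos_phase measurableSet_Ioo (fun k _ => hderiv k) hinj hne hfi
  have hw : Tendsto (fun t : ℕ => 2 / π * (t : ℝ)) atTop (cocompact ℝ) :=
    (tendsto_natCast_atTop_atTop.const_mul_atTop (by positivity)).mono_right atTop_le_cocompact
  refine (hRL.comp hw).congr fun t => ?_
  rw [intervalIntegral.integral_of_le Real.pi_pos.le, MeasureTheory.integral_Ioc_eq_integral_Ioo]
  refine MeasureTheory.setIntegral_congr_ae measurableSet_Ioo ?_
  filter_upwards [ae_one_sub_two_mul_sq_ne_zero ha0.ne'] with k hk hk0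
  rw [cos_two_nat_mul_epsDisp ω k t (hk hk0), ← ha]
  congr 2
  field_simp
  ring

theorem floquet_xx_relaxation (ω : ℝ) (hω : ω ∈ Set.Ioo 0 π) :
    Tendsto (fun t : ℕ => ∫ k in (0 : ℝ)..π, fOcc ω k * Real.cos (2 * t * epsDisp ω k))
      atTop (nhds 0) ∧
    ∀ x : ℤ,
      Tendsto (fun t : ℕ =>
          ((-1 : ℝ)) ^ x * (1 / (4 * π)) *
            ∫ k in (0 : ℝ)..π, (gOcc ω k + fOcc ω k * Real.cos (2 * t * epsDisp ω k)))
        atTop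
        (nhds (((-1 : ℝ)) ^ x * (1 / (4 * π)) * ∫ k in (0 : ℝ)..π, gOcc ω k)) := by
  have hlim := tendsto_integral_fOcc_mul_cos hω
  refine ⟨hlim, fun x => Tendsto.const_mul _ ?_⟩
  have hsum := hlim.const_add (∫ k in (0 : ℝ)..π, gOcc ω k)
  rw [add_zero] at hsum
  refine hsum.congr fun t => (intervalIntegral.integral_add ?_ ?_).symm
  · exact intervalIntegrable_of_measurable_of_abs_le (measurable_gOcc ω) (abs_gOcc_le_one ω) 0 π
  · refine intervalIntegrable_of_measurable_of_abs_le (C := 1) ?_ (fun k => ?_) 0 π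
    · exact (measurable_fOcc ω).mul
        (Real.measurable_cos.comp ((measurable_epsDisp ω).const_mul _))
    · rw [abs_mul]
      exact mul_le_one₀ (abs_fOcc_le_one ω k) (abs_nonneg _) (Real.abs_cos_le_one _)
end
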